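/- arXiv:1906.00036 — 2 statements merged into one kernel-verified Lean document; each statement's English description precedes it below -/
import Mathlib

section
/- Let W be a finite real reflection group acting on V = ℝⁿ with reflection arrangement 𝒜_W and intersection lattice L. For every intersection subspace X ∈ L, the Möbius function of the interval [V, X] in L satisfies μ(V, X) = (−1)^{n − dim X} · #{w ∈ W : V^w = X}, where V^w is the fixed space of w. -/
open scoped Classical

noncomputable section

/-- The fixed subspace `V^w = {x | w x = x}` of an orthogonal transformation of `ℝⁿ`. -/
def fixedSpace {n : ℕ} (w : EuclideanSpace ℝ (Fin n) ≃ₗᵢ[ℝ] EuclideanSpace ℝ (Fin n)) :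
    Submodule ℝ (EuclideanSpace ℝ (Fin n)) :=
  LinearMap.eqLocus (w.toLinearEquiv : EuclideanSpace ℝ (Fin n) →ₗ[ℝ] EuclideanSpace ℝ (Fin n))
    LinearMap.id

/-- An orthogonal transformation is a reflection if its fixed space is a hyperplane. -/
def IsReflection {n : ℕ} (w : EuclideanSpace ℝ (Fin n) ≃ₗᵢ[ℝ] EuclideanSpace ℝ (Fin n)) : Prop :=
  w ≠ 1 ∧ Module.finrank ℝ (fixedSpace w) = n - 1

/-- The reflecting hyperplanes of a group of orthogonal transformations. -/
def reflHyperplanes {n : ℕ}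
    (W : Subgroup (EuclideanSpace ℝ (Fin n) ≃ₗᵢ[ℝ] EuclideanSpace ℝ (Fin n))) :
    Set (Submodule ℝ (EuclideanSpace ℝ (Fin n))) :=
  {H | ∃ w ∈ W, IsReflection w ∧ fixedSpace w = H}

/-- The intersection lattice of the reflection arrangement: all intersections of collections
of reflecting hyperplanes (the empty intersection being all of `V = ℝⁿ`, i.e. `⊤`). -/
def intLattice {n : ℕ}
    (W : Subgroup (EuclideanSpace ℝ (Fin n) ≃ₗᵢ[ℝ] EuclideanSpace ℝ (Fin n))) :
    Set (Submodule ℝ (EuclideanSpace ℝ (Fin n))) :=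
  {X | ∃ s : Set (Submodule ℝ (EuclideanSpace ℝ (Fin n))), s ⊆ reflHyperplanes W ∧ X = sInf s}

open scoped InnerProductSpace

section RootSystem

variable {E : Type*} [NormedAddCommGroup E] [InnerProductSpace ℝ E]

/-- The orthogonal reflection in the hyperplane perpendicular to `α`. -/
def rootReflection (α : E) : E ≃ₗᵢ[ℝ] E := (ℝ ∙ α)ᗮ.reflection

theorem rootReflection_apply {α : E} (hα : ‖α‖ = 1) (v : E) :
    rootReflection α v = v - (2 * ⟪α, v⟫_ℝ) • α := by
  rw [rootReflection, Submodule.reflection_orthogonal_apply,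
    Submodule.reflection_singleton_apply, hα]
  simp [two_smul, add_smul, two_mul]

theorem rootReflection_self (α : E) : rootReflection α α = -α :=
  Submodule.reflection_orthogonalComplement_singleton_eq_neg α

theorem rootReflection_mul_self (α : E) : rootReflection α * rootReflection α = 1 :=
  Submodule.reflection_mul_reflection _

theorem rootReflection_eq_self_iff {α v : E} : rootReflection α v = v ↔ ⟪α, v⟫_ℝ = 0 := by
  rw [rootReflection, Submodule.reflection_eq_self_iff,
    Submodule.mem_orthogonal_singleton_iff_inner_right]

theorem rootReflection_map (f : E ≃ₗᵢ[ℝ] E) (α : E) :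
    rootReflection (f α) = f * rootReflection α * f⁻¹ := by
  ext x
  have h := Submodule.reflection_map_apply f.symm (ℝ ∙ f α) (f⁻¹ x)
  have hmap : (ℝ ∙ f α).map (f.symm.toLinearEquiv : E →ₗ[ℝ] E) = ℝ ∙ α := by
    simp [Submodule.map_span]
  have hx : f.symm.symm (f⁻¹ x) = x := f.apply_symm_apply x
  rw [hx] at h
  simp only [hmap] at h
  simp only [rootReflection, Submodule.reflection_orthogonal_apply, LinearIsometryEquiv.coe_mul,
    Function.comp_apply, map_neg, h, LinearIsometryEquiv.apply_symm_apply]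

theorem rootReflection_smul {c : ℝ} (hc : c ≠ 0) (α : E) :
    rootReflection (c • α) = rootReflection α := by
  have h : (ℝ ∙ c • α) = ℝ ∙ α := Submodule.span_singleton_smul_eq (IsUnit.mk0 c hc) α
  ext x
  simp only [rootReflection, Submodule.reflection_orthogonal_apply, h]

theorem rootReflection_neg (α : E) : rootReflection (-α) = rootReflection α := by
  simpa using rootReflection_smul (neg_ne_zero.2 one_ne_zero) α

theorem eq_or_eq_neg_of_rootReflection_eq {α β : E} (hα : ‖α‖ = 1) (hβ : ‖β‖ = 1)
    (h : rootReflection α = rootReflection β) : α = β ∨ α = -β := by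
  have h₁ := rootReflection_apply hβ α
  rw [← h, rootReflection_self] at h₁
  have h₂ : α = ⟪β, α⟫_ℝ • β := by
    have : (2 : ℝ) • α = (2 : ℝ) • (⟪β, α⟫_ℝ • β) := by
      rw [smul_smul, two_smul]
      have h₂ := congrArg (fun v => α - v) h₁
      simpa using h₂
    exact smul_right_injective E two_ne_zero this
  have h₃ : |⟪β, α⟫_ℝ| = 1 := by
    have := congrArg norm h₂
    rw [norm_smul, hα, hβ, mul_one, Real.norm_eq_abs] at this
    exact this.symm
  rcases eq_or_eq_neg_of_abs_eq h₃ with h₄ | h₄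
  · left; rw [h₂, h₄, one_smul]
  · right; rw [h₂, h₄, neg_smul, one_smul]

/-- A finite set of unit vectors stable under the reflections it defines. -/
structure IsUnitRootSystem (R : Set E) : Prop where
  finite : R.Finite
  norm_eq_one : ∀ α ∈ R, ‖α‖ = 1
  reflection_mem : ∀ α ∈ R, ∀ β ∈ R, rootReflection α β ∈ R

/-- The roots positive with respect to `z`. -/
def IsPositiveRoot (R : Set E) (z β : E) : Prop := β ∈ R ∧ 0 < ⟪β, z⟫_ℝ

/-- A positive root whose reflection permutes the other positive roots. -/
def IsSimpleRoot (R : Set E) (z α : E) : Prop :=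
  IsPositiveRoot R z α ∧ ∀ β, IsPositiveRoot R z β → β ≠ α → IsPositiveRoot R z (rootReflection α β)

/-- The product of the reflections defined by a list of vectors. -/
def rootWord (l : List E) : E ≃ₗᵢ[ℝ] E := (l.map rootReflection).prod

theorem rootWord_nil : rootWord ([] : List E) = 1 := rfl

theorem rootWord_cons (α : E) (l : List E) : rootWord (α :: l) = rootReflection α * rootWord l := by
  simp [rootWord]

theorem rootWord_append (l l' : List E) : rootWord (l ++ l') = rootWord l * rootWord l' := by
  simp [rootWord]

theorem rootWord_reverse (l : List E) : rootWord l.reverse = (rootWord l)⁻¹ := by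
  induction l with
  | nil => simp [rootWord_nil]
  | cons α l ih =>
    rw [List.reverse_cons, rootWord_append, ih, rootWord_cons, rootWord_cons, rootWord_nil,
      mul_one, mul_inv_rev, inv_eq_of_mul_eq_one_right (rootReflection_mul_self α)]

namespace IsUnitRootSystem

variable {R : Set E} {z : E}

theorem neg_mem (hR : IsUnitRootSystem R) {α : E} (hα : α ∈ R) : -α ∈ R := by
  simpa [rootReflection_self] using hR.reflection_mem α hα α hα

theorem rootWord_mem (hR : IsUnitRootSystem R) {l : List E} (hl : ∀ α ∈ l, α ∈ R) {β : E}
    (hβ : β ∈ R) :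
    rootWord l β ∈ R := by
  induction l with
  | nil => exact hβ
  | cons α l ih =>
    rw [rootWord_cons]
    exact hR.reflection_mem α (hl α (by simp)) _ (ih fun γ hγ => hl γ (by simp [hγ]))

/-- A multiple of a positive root that is not simple is a sum of two positive roots. -/
theorem exists_smul_eq_add (hR : IsUnitRootSystem R) (hz : ∀ α ∈ R, ⟪α, z⟫_ℝ ≠ 0) {β : E}
    (hβ : IsPositiveRoot R z β)
    (hs : ¬ IsSimpleRoot R z β) :
    ∃ c < (2 : ℝ), ∃ γ γ' : E, IsPositiveRoot R z γ ∧ IsPositiveRoot R z γ' ∧ c • β = γ + γ' := by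
  simp only [IsSimpleRoot, hβ, true_and, not_forall] at hs
  obtain ⟨γ, hγ, hne, hn⟩ := hs
  have hm := hR.reflection_mem β hβ.1 γ hγ.1
  have hβ1 := hR.norm_eq_one β hβ.1
  refine ⟨2 * ⟪β, γ⟫_ℝ, ?_, γ, -rootReflection β γ, hγ, ⟨hR.neg_mem hm, ?_⟩, ?_⟩
  · have := inner_lt_one_iff_real_of_norm_eq_one hβ1 (hR.norm_eq_one γ hγ.1)
    linarith [this.2 hne.symm]
  · have h := hz _ hm
    have h' : ¬ 0 < ⟪rootReflection β γ, z⟫_ℝ := fun h' => hn ⟨hm, h'⟩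
    rw [inner_neg_left]
    linarith [lt_of_le_of_ne (not_lt.1 h') h]
  · rw [rootReflection_apply hβ1]
    abel

theorem exists_simpleRoot_inner_neg (hR : IsUnitRootSystem R) (hz : ∀ α ∈ R, ⟪α, z⟫_ℝ ≠ 0) {x : E}
    (h : ∃ β, IsPositiveRoot R z β ∧ ⟪β, x⟫_ℝ < 0) :
    ∃ α, IsSimpleRoot R z α ∧ ⟪α, x⟫_ℝ < 0 := by
  obtain ⟨β₀, hβ₀, hx₀⟩ := h
  have hfin : {β | IsPositiveRoot R z β}.Finite := hR.finite.subset fun β hβ => hβ.1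
  obtain ⟨β₁, hβ₁, hmin₁⟩ := Set.exists_min_image _ (fun β => ⟪β, x⟫_ℝ / ⟪β, z⟫_ℝ) hfin ⟨β₀, hβ₀⟩
  set r := ⟪β₁, x⟫_ℝ / ⟪β₁, z⟫_ℝ with hr
  have hr0 : r < 0 := (hmin₁ β₀ hβ₀).trans_lt (div_neg_of_neg_of_pos hx₀ hβ₀.2)
  have hle : ∀ β, IsPositiveRoot R z β → r * ⟪β, z⟫_ℝ ≤ ⟪β, x⟫_ℝ := fun β hβ =>
    (le_div_iff₀ hβ.2).1 (hmin₁ β hβ)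
  obtain ⟨β, ⟨hβ, hβr⟩, hmin⟩ := Set.exists_min_image
    {β | IsPositiveRoot R z β ∧ ⟪β, x⟫_ℝ = r * ⟪β, z⟫_ℝ} (fun β => ⟪β, z⟫_ℝ)
    (hfin.subset fun β hβ => hβ.1) ⟨β₁, hβ₁, (div_eq_iff hβ₁.2.ne').1 hr.symm⟩
  refine ⟨β, ?_, by rw [hβr]; exact mul_neg_of_neg_of_pos hr0 hβ.2⟩
  by_contra hs
  obtain ⟨c, hc, γ, γ', hγ, hγ', hsum⟩ := hR.exists_smul_eq_add hz hβ hs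
  have hsx := congrArg (fun v => ⟪v, x⟫_ℝ) hsum
  have hsz := congrArg (fun v => ⟪v, z⟫_ℝ) hsum
  simp only [inner_add_left, real_inner_smul_left] at hsx hsz
  have h₁ := hle γ hγ
  have h₂ := hle γ' hγ'
  have heq : r * ⟪γ, z⟫_ℝ + r * ⟪γ', z⟫_ℝ = ⟪γ, x⟫_ℝ + ⟪γ', x⟫_ℝ := by
    rw [← hsx, hβr, ← mul_add, ← hsz]; ring
  have h₃ := hmin γ ⟨hγ, by linarith⟩
  have h₄ := hmin γ' ⟨hγ', by linarith⟩
  have h₅ := hβ.2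
  nlinarith

/-- Reflections in positive roots are products of reflections in simple roots. -/
theorem exists_rootWord_eq_of_positive (hR : IsUnitRootSystem R) (hz : ∀ α ∈ R, ⟪α, z⟫_ℝ ≠ 0)
    {β : E} (hβ : IsPositiveRoot R z β) :
    ∃ l : List E, (∀ α ∈ l, IsSimpleRoot R z α) ∧ rootWord l = rootReflection β := by
  by_contra hcon
  obtain ⟨β, ⟨hβ, hno⟩, hmin⟩ := Set.exists_min_image
    {β | IsPositiveRoot R z β ∧
      ¬ ∃ l : List E, (∀ α ∈ l, IsSimpleRoot R z α) ∧ rootWord l = rootReflection β}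
    (fun β => ⟪β, z⟫_ℝ) (hR.finite.subset fun β hβ => hβ.1.1) ⟨β, hβ, hcon⟩
  obtain ⟨α, hα, hneg⟩ := hR.exists_simpleRoot_inner_neg hz (x := -β) ⟨β, hβ, by
    rw [inner_neg_right, real_inner_self_eq_norm_sq, hR.norm_eq_one β hβ.1]; norm_num⟩
  rw [inner_neg_right] at hneg
  by_cases hne : β = α
  · exact hno ⟨[α], by simpa using hα, by simp [rootWord, hne]⟩
  have hpos := hα.2 β hβ hne
  refine (hmin _ ⟨hpos, ?_⟩).not_gt ?_
  · rintro ⟨l, hl, hw⟩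
    refine hno ⟨α :: l ++ [α], by simpa [or_imp, forall_and, hα] using hl, ?_⟩
    have hinv : (rootReflection α)⁻¹ = rootReflection α :=
      inv_eq_of_mul_eq_one_right (rootReflection_mul_self α)
    rw [rootWord_append, rootWord_cons, hw, rootReflection_map, rootWord_cons, rootWord_nil, hinv,
      mul_one, mul_assoc, mul_assoc, rootReflection_mul_self, mul_one, ← mul_assoc,
      rootReflection_mul_self, one_mul]
  · rw [rootReflection_apply (hR.norm_eq_one α hα.1.1), inner_sub_left, real_inner_smul_left]
    have := hα.1.2
    nlinarith

theorem exists_rootWord_eq (hR : IsUnitRootSystem R) (hz : ∀ α ∈ R, ⟪α, z⟫_ℝ ≠ 0) {β : E}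
    (hβ : β ∈ R) :
    ∃ l : List E, (∀ α ∈ l, IsSimpleRoot R z α) ∧ rootWord l = rootReflection β := by
  rcases (hz β hβ).lt_or_gt with h | h
  · rw [← rootReflection_neg]
    exact hR.exists_rootWord_eq_of_positive hz ⟨hR.neg_mem hβ, by simpa using h⟩
  · exact hR.exists_rootWord_eq_of_positive hz ⟨hβ, h⟩

/-- The exchange condition. -/
theorem exists_rootWord_mul_eq (hR : IsUnitRootSystem R) (hz : ∀ α ∈ R, ⟪α, z⟫_ℝ ≠ 0) {l : List E}
    (hl : ∀ α ∈ l, IsSimpleRoot R z α) {α : E} (hα : IsPositiveRoot R z α)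
    (hneg : ⟪rootWord l α, z⟫_ℝ < 0) :
    ∃ l' : List E, (∀ α ∈ l', IsSimpleRoot R z α) ∧ l'.length + 1 = l.length ∧
      rootWord l' = rootWord l * rootReflection α := by
  induction l with
  | nil => exact absurd hα.2 hneg.not_gt
  | cons β t ih =>
    have ht : ∀ α ∈ t, IsSimpleRoot R z α := fun γ hγ => hl γ (by simp [hγ])
    have hβ : IsSimpleRoot R z β := hl β (by simp)
    have hm : rootWord t α ∈ R := hR.rootWord_mem (fun γ hγ => (ht γ hγ).1.1) hα.1
    rcases (hz _ hm).lt_or_gt with h | h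
    · obtain ⟨t', ht', hlen, hw⟩ := ih ht h
      refine ⟨β :: t', ?_, by simp [hlen], by rw [rootWord_cons, rootWord_cons, hw, mul_assoc]⟩
      simpa [hβ] using ht'
    · have heq : rootWord t α = β := by
        by_contra hne
        rw [rootWord_cons] at hneg
        exact (hβ.2 _ ⟨hm, h⟩ hne).2.not_gt hneg
      refine ⟨t, ht, rfl, ?_⟩
      rw [rootWord_cons, ← heq, rootReflection_map, inv_mul_cancel_right, mul_assoc,
        rootReflection_mul_self, mul_one]

/-- An element fixing a dominant vector `x` fixes every vector lying on all reflecting hyperplanes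
through `x`. -/
theorem rootWord_apply_eq_self (hR : IsUnitRootSystem R) (hz : ∀ α ∈ R, ⟪α, z⟫_ℝ ≠ 0)
    {x y : E}
    (hx : ∀ α, IsPositiveRoot R z α → 0 ≤ ⟪α, x⟫_ℝ)
    (hxy : ∀ α ∈ R, ⟪α, x⟫_ℝ = 0 → ⟪α, y⟫_ℝ = 0) {l : List E}
    (hl : ∀ α ∈ l, IsSimpleRoot R z α) (hfix : rootWord l x = x) : rootWord l y = y := by
  induction hn : l.length using Nat.strong_induction_on generalizing l with
  | _ k ih =>
  by_cases hex : ∃ α, IsSimpleRoot R z α ∧ ⟪rootWord l α, z⟫_ℝ < 0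
  · obtain ⟨α, hα, hneg⟩ := hex
    obtain ⟨l', hl', hlen, hw⟩ := hR.exists_rootWord_mul_eq hz hl hα.1 hneg
    have hm := hR.rootWord_mem (fun γ hγ => (hl γ hγ).1.1) hα.1.1
    have hαx : ⟪α, x⟫_ℝ = 0 := by
      refine le_antisymm ?_ (hx α hα.1)
      have h₁ := hx (-rootWord l α) ⟨hR.neg_mem hm, by rw [inner_neg_left]; linarith⟩
      have h₂ := (rootWord l).inner_map_map α x
      rw [hfix] at h₂
      rw [inner_neg_left, h₂] at h₁
      linarith
    have key : ∀ v, ⟪α, v⟫_ℝ = 0 → rootWord l' v = rootWord l v := fun v hv => by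
      rw [hw, LinearIsometryEquiv.coe_mul, Function.comp_apply, rootReflection_eq_self_iff.2 hv]
    rw [← key y (hxy α hα.1.1 hαx)]
    exact ih l'.length (by omega) hl' ((key x hαx).trans hfix) rfl
  · push Not at hex
    rcases List.eq_nil_or_concat' l with rfl | ⟨l₀, α, rfl⟩
    · rfl
    have hα : IsSimpleRoot R z α := hl α (by simp)
    have hl₀ : ∀ β ∈ l₀, IsSimpleRoot R z β := fun β hβ => hl β (by simp [hβ])
    have hw : rootWord (l₀ ++ [α]) = rootWord l₀ * rootReflection α := by
      rw [rootWord_append, rootWord_cons, rootWord_nil, mul_one]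
    have hm := hR.rootWord_mem (fun γ hγ => (hl γ hγ).1.1) hα.1.1
    have hneg : ⟪rootWord l₀ α, z⟫_ℝ < 0 := by
      have h₁ := lt_of_le_of_ne (hex α hα) (hz _ hm).symm
      rw [hw, LinearIsometryEquiv.coe_mul, Function.comp_apply, rootReflection_self, map_neg,
        inner_neg_left] at h₁
      linarith
    obtain ⟨l', hl', hlen, hw'⟩ := hR.exists_rootWord_mul_eq hz hl₀ hα.1 hneg
    rw [← hw] at hw'
    rw [← hw'] at hfix ⊢
    refine ih l'.length ?_ hl' hfix rfl
    simp at hn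
    omega

end IsUnitRootSystem

end RootSystem

section FiniteReflectionGroup

variable {E : Type*} [NormedAddCommGroup E] [InnerProductSpace ℝ E]

/-- The unit normals of the reflections contained in `W`. -/
def unitRoots (W : Subgroup (E ≃ₗᵢ[ℝ] E)) : Set E := {α | ‖α‖ = 1 ∧ rootReflection α ∈ W}

theorem isUnitRootSystem_unitRoots (W : Subgroup (E ≃ₗᵢ[ℝ] E)) [Finite W] :
    IsUnitRootSystem (unitRoots W) where
  finite := by
    have hW : (W : Set (E ≃ₗᵢ[ℝ] E)).Finite := Set.toFinite _
    refine Set.Finite.of_finite_fibers rootReflection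
      (hW.subset (Set.image_subset_iff.2 fun α hα => hα.2)) ?_
    rintro _ ⟨α, hα, rfl⟩
    refine (Set.toFinite {α, -α}).subset fun β hβ => ?_
    exact eq_or_eq_neg_of_rootReflection_eq hβ.1.1 hα.1 hβ.2
  norm_eq_one α hα := hα.1
  reflection_mem α hα β hβ :=
    ⟨by rw [LinearIsometryEquiv.norm_map, hβ.1], by
      rw [rootReflection_map]
      exact W.mul_mem (W.mul_mem hα.2 hβ.2) (W.inv_mem hα.2)⟩

theorem exists_rootWord_eq_of_mem_closure {R : Set E} (hR : IsUnitRootSystem R) {z : E}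
    (hz : ∀ α ∈ R, ⟪α, z⟫_ℝ ≠ 0) {w : E ≃ₗᵢ[ℝ] E}
    (hw : w ∈ Subgroup.closure (rootReflection '' R)) :
    ∃ l : List E, (∀ α ∈ l, IsSimpleRoot R z α) ∧ rootWord l = w := by
  induction hw using Subgroup.closure_induction with
  | mem _ h =>
    obtain ⟨β, hβ, rfl⟩ := h
    exact hR.exists_rootWord_eq hz hβ
  | one => exact ⟨[], by simp, rfl⟩
  | mul _ _ _ _ h₁ h₂ =>
    obtain ⟨l₁, hl₁, rfl⟩ := h₁
    obtain ⟨l₂, hl₂, rfl⟩ := h₂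
    refine ⟨l₁ ++ l₂, fun α hα => ?_, rootWord_append _ _⟩
    exact (List.mem_append.1 hα).elim (hl₁ α) (hl₂ α)
  | inv _ _ h =>
    obtain ⟨l, hl, rfl⟩ := h
    exact ⟨l.reverse, by simpa using hl, rootWord_reverse l⟩

/-- Every vector is dominant for a suitable regular vector `z`. -/
theorem exists_regular_dominant {R : Set E} (hR : IsUnitRootSystem R) (x : E) :
    ∃ z, (∀ α ∈ R, ⟪α, z⟫_ℝ ≠ 0) ∧ ∀ α, IsPositiveRoot R z α → 0 ≤ ⟪α, x⟫_ℝ := by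
  have := hR.finite.to_subtype
  obtain ⟨y, hy⟩ := Module.Dual.exists_forall_ne_zero_of_forall_exists
    (fun α : R => (innerₛₗ ℝ (α : E))) fun α => ⟨α, by
      simp [hR.norm_eq_one α α.2]⟩
  have hev : ∀ᶠ ε : ℝ in nhdsWithin 0 (Set.Ioi 0),
      ∀ α ∈ R, ⟪α, x⟫_ℝ < 0 → ⟪α, x + ε • y⟫_ℝ < 0 := by
    refine (Filter.eventually_all_finite hR.finite).2 fun α _ => ?_
    by_cases h : ⟪α, x⟫_ℝ < 0
    · have hc : Continuous fun ε : ℝ => ⟪α, x + ε • y⟫_ℝ := by fun_prop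
      have := (hc.tendsto 0).eventually_lt_const (u := 0) (by simpa using h)
      exact (this.filter_mono nhdsWithin_le_nhds).mono fun ε hε _ => hε
    · exact Filter.Eventually.of_forall fun ε h' => absurd h' h
  have hev' : ∀ᶠ ε : ℝ in nhdsWithin 0 (Set.Ioi 0),
      ∀ α ∈ R, 0 < ⟪α, x⟫_ℝ → 0 < ⟪α, x + ε • y⟫_ℝ := by
    filter_upwards [hev] with ε hε α hα hpos
    have := hε (-α) (hR.neg_mem hα) (by simpa using hpos)
    simpa using this
  obtain ⟨ε, hneg, hpos, hε⟩ := (hev.and (hev'.and self_mem_nhdsWithin)).exists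
  refine ⟨x + ε • y, fun α hα => ?_, fun α hα => ?_⟩
  · rcases lt_trichotomy ⟪α, x⟫_ℝ 0 with h | h | h
    · exact (hneg α hα h).ne
    · rw [inner_add_right, h, zero_add, real_inner_smul_right]
      exact mul_ne_zero (ne_of_gt hε) (hy ⟨α, hα⟩)
    · exact (hpos α hα h).ne'
  · by_contra! h
    exact (hneg α hα.1 h).not_gt hα.2

/-- A subspace contains a vector lying on no more of the hyperplanes orthogonal to a finite set
of vectors than the subspace itself. -/
theorem exists_generic_mem {R : Set E} (hR : R.Finite) (X : Submodule ℝ E) :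
    ∃ x ∈ X, ∀ α ∈ R, ⟪α, x⟫_ℝ = 0 → ∀ y ∈ X, ⟪α, y⟫_ℝ = 0 := by
  have := (hR.subset (Set.sep_subset R fun α => ∃ y ∈ X, ⟪α, y⟫_ℝ ≠ 0)).to_subtype
  obtain ⟨x, hxX, hx⟩ := Module.Dual.exists_forall_mem_ne_zero_of_forall_exists X
    (fun α : {α ∈ R | ∃ y ∈ X, ⟪α, y⟫_ℝ ≠ 0} => (innerₛₗ ℝ (α : E))) fun α => α.2.2
  refine ⟨x, hxX, fun α hα h y hy => ?_⟩
  by_contra hne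
  exact hx ⟨α, hα, y, hy, hne⟩ h

/-- In a finite reflection group, a vector lying on every reflecting hyperplane that contains the
fixed space of `w` is itself fixed by `w`. -/
theorem apply_eq_self_of_forall_root {W : Subgroup (E ≃ₗᵢ[ℝ] E)} [Finite W] {w : E ≃ₗᵢ[ℝ] E}
    (hw : w ∈ Subgroup.closure (rootReflection '' unitRoots W)) {y : E}
    (hy : ∀ α ∈ unitRoots W, (∀ v, w v = v → ⟪α, v⟫_ℝ = 0) → ⟪α, y⟫_ℝ = 0) : w y = y := by
  have hR := isUnitRootSystem_unitRoots W
  obtain ⟨x, hx, hgen⟩ := exists_generic_mem hR.finite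
    (LinearMap.eqLocus (w.toLinearEquiv : E →ₗ[ℝ] E) LinearMap.id)
  obtain ⟨z, hz, hdom⟩ := exists_regular_dominant hR x
  obtain ⟨l, hl, rfl⟩ := exists_rootWord_eq_of_mem_closure hR hz hw
  exact hR.rootWord_apply_eq_self hz hdom
    (fun α hα h => hy α hα fun v hv => hgen α hα h v hv) hl hx

end FiniteReflectionGroup

section Euclidean

variable {n : ℕ}

local notation "𝔼" n => EuclideanSpace ℝ (Fin n)

theorem mem_fixedSpace {w : (𝔼 n) ≃ₗᵢ[ℝ] (𝔼 n)} {x : 𝔼 n} : x ∈ fixedSpace w ↔ w x = x := Iff.rfl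

theorem fixedSpace_rootReflection (α : 𝔼 n) : fixedSpace (rootReflection α) = (ℝ ∙ α)ᗮ := by
  ext x
  rw [mem_fixedSpace, rootReflection_eq_self_iff,
    Submodule.mem_orthogonal_singleton_iff_inner_right]

theorem fixedSpace_eq_top_iff {w : (𝔼 n) ≃ₗᵢ[ℝ] (𝔼 n)} : fixedSpace w = ⊤ ↔ w = 1 := by
  refine ⟨fun h => ?_, fun h => ?_⟩
  · ext1 x
    exact mem_fixedSpace.1 (h ▸ Submodule.mem_top)
  · subst h
    exact eq_top_iff.2 fun x _ => rfl

theorem fixedSpace_one : fixedSpace (1 : (𝔼 n) ≃ₗᵢ[ℝ] (𝔼 n)) = ⊤ := fixedSpace_eq_top_iff.2 rfl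

theorem ker_id_sub_eq_fixedSpace (w : (𝔼 n) ≃ₗᵢ[ℝ] (𝔼 n)) :
    (ContinuousLinearMap.id ℝ (𝔼 n) - w).ker = fixedSpace w := by
  ext x
  rw [mem_fixedSpace, LinearMap.mem_ker]
  exact sub_eq_zero.trans eq_comm

theorem exists_rootWord_eq_of_fixedSpace (w : (𝔼 n) ≃ₗᵢ[ℝ] (𝔼 n)) :
    ∃ l : List (𝔼 n), l.length + Module.finrank ℝ (fixedSpace w) ≤ n ∧ w = rootWord l := by
  obtain ⟨l, hl, hw⟩ := w.reflections_generate_dim_aux le_rfl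
  refine ⟨l, ?_, hw⟩
  rw [ker_id_sub_eq_fixedSpace] at hl
  have := (fixedSpace w).finrank_add_finrank_orthogonal
  rw [finrank_euclideanSpace_fin] at this
  omega

theorem finrank_orthogonal_singleton_add_one {α : 𝔼 n} (hα : α ≠ 0) :
    Module.finrank ℝ (ℝ ∙ α)ᗮ + 1 = n := by
  have h := (ℝ ∙ α).finrank_add_finrank_orthogonal
  rw [finrank_euclideanSpace_fin, finrank_span_singleton hα] at h
  omega

theorem rootReflection_zero : rootReflection (0 : 𝔼 n) = 1 := by
  ext1 x
  exact rootReflection_eq_self_iff.2 (inner_zero_left x)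

theorem isReflection_rootReflection {α : 𝔼 n} (hα : α ≠ 0) : IsReflection (rootReflection α) := by
  have h := finrank_orthogonal_singleton_add_one hα
  have hf : Module.finrank ℝ (fixedSpace (rootReflection α)) = n - 1 := by
    rw [fixedSpace_rootReflection]; omega
  refine ⟨fun h1 => ?_, hf⟩
  rw [fixedSpace_eq_top_iff.2 h1, finrank_top, finrank_euclideanSpace_fin] at hf
  omega

theorem IsReflection.exists_rootReflection {w : (𝔼 n) ≃ₗᵢ[ℝ] (𝔼 n)} (hw : IsReflection w) :
    ∃ α : 𝔼 n, ‖α‖ = 1 ∧ rootReflection α = w := by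
  obtain ⟨l, hl, rfl⟩ := exists_rootWord_eq_of_fixedSpace w
  rw [hw.2] at hl
  match l, hl, hw with
  | [], _, hw => exact absurd rootWord_nil hw.1
  | [α], _, hw =>
    have hα : α ≠ 0 := by
      rintro rfl
      exact hw.1 (by rw [rootWord_cons, rootReflection_zero, rootWord_nil, mul_one])
    refine ⟨‖α‖⁻¹ • α, norm_smul_inv_norm hα, ?_⟩
    rw [rootReflection_smul (inv_ne_zero (norm_ne_zero_iff.2 hα)), rootWord_cons, rootWord_nil,
      mul_one]
  | _ :: _ :: _, hl, _ =>
    simp only [List.length_cons] at hl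
    omega

theorem closure_rootReflection_unitRoots {W : Subgroup ((𝔼 n) ≃ₗᵢ[ℝ] (𝔼 n))}
    (hgen : Subgroup.closure {w | w ∈ W ∧ IsReflection w} = W) :
    Subgroup.closure (rootReflection '' unitRoots W) = W := by
  refine le_antisymm ((Subgroup.closure_le W).2 (Set.image_subset_iff.2 fun α hα => hα.2)) ?_
  conv_lhs => rw [← hgen]
  refine Subgroup.closure_mono ?_
  rintro w ⟨hw, hr⟩
  obtain ⟨α, hα, rfl⟩ := hr.exists_rootReflection
  exact ⟨α, ⟨hα, hw⟩, rfl⟩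

/-- The fixed space of an element of a finite reflection group is an intersection of reflecting
hyperplanes. -/
theorem fixedSpace_mem_intLattice {W : Subgroup ((𝔼 n) ≃ₗᵢ[ℝ] (𝔼 n))} [Finite W]
    (hgen : Subgroup.closure {w | w ∈ W ∧ IsReflection w} = W) {w : (𝔼 n) ≃ₗᵢ[ℝ] (𝔼 n)}
    (hw : w ∈ W) : fixedSpace w ∈ intLattice W := by
  refine ⟨{H | H ∈ reflHyperplanes W ∧ fixedSpace w ≤ H}, fun H hH => hH.1,
    le_antisymm (le_sInf fun H hH => hH.2) fun y hy => ?_⟩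
  rw [← closure_rootReflection_unitRoots hgen] at hw
  refine apply_eq_self_of_forall_root hw fun α hα hfix => ?_
  have hα0 : α ≠ 0 := norm_ne_zero_iff.1 (by rw [hα.1]; exact one_ne_zero)
  rw [Submodule.mem_sInf] at hy
  refine rootReflection_eq_self_iff.1 (hy (fixedSpace (rootReflection α))
    ⟨⟨_, hα.2, isReflection_rootReflection hα0, rfl⟩, fun v hv => ?_⟩)
  exact rootReflection_eq_self_iff.2 (hfix v hv)

/-- The determinant of an orthogonal transformation. -/
def isometryDet : ((𝔼 n) ≃ₗᵢ[ℝ] (𝔼 n)) →* ℝ where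
  toFun w := LinearMap.det (w.toLinearEquiv : (𝔼 n) →ₗ[ℝ] (𝔼 n))
  map_one' := LinearMap.det_id
  map_mul' _ _ := LinearMap.det_comp _ _

theorem isometryDet_rootReflection {α : 𝔼 n} (hα : α ≠ 0) :
    isometryDet (rootReflection α) = -1 := by
  refine ((ℝ ∙ α)ᗮ.det_reflection).trans ?_
  rw [Submodule.orthogonal_orthogonal, finrank_span_singleton hα, pow_one]

theorem isometryDet_rootWord (l : List (𝔼 n)) :
    n ≤ Module.finrank ℝ (fixedSpace (rootWord l)) + l.length ∧
      (n = Module.finrank ℝ (fixedSpace (rootWord l)) + l.length →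
        isometryDet (rootWord l) = (-1) ^ l.length) := by
  induction l with
  | nil =>
    rw [rootWord_nil, fixedSpace_one, finrank_top, finrank_euclideanSpace_fin]
    simp
  | cons α t ih =>
    rw [List.length_cons]
    by_cases hα : α = 0
    · rw [rootWord_cons, hα, rootReflection_zero, one_mul]
      exact ⟨by omega, fun h => by omega⟩
    have hle : fixedSpace (rootWord t) ⊓ (ℝ ∙ α)ᗮ ≤ fixedSpace (rootWord (α :: t)) := by
      rintro x ⟨hx, hxα⟩
      rw [← fixedSpace_rootReflection] at hxα
      rw [mem_fixedSpace, rootWord_cons, LinearIsometryEquiv.coe_mul, Function.comp_apply,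
        mem_fixedSpace.1 hx, mem_fixedSpace.1 hxα]
    have h₁ := Submodule.finrank_mono hle
    have h₂ := Submodule.finrank_sup_add_finrank_inf_eq (fixedSpace (rootWord t)) (ℝ ∙ α)ᗮ
    have h₃ := (fixedSpace (rootWord t) ⊔ (ℝ ∙ α)ᗮ).finrank_le
    rw [finrank_euclideanSpace_fin] at h₃
    have h₄ := finrank_orthogonal_singleton_add_one hα
    refine ⟨by omega, fun h => ?_⟩
    rw [rootWord_cons, map_mul, isometryDet_rootReflection hα, ih.2 (by omega), pow_succ']

theorem isometryDet_eq (w : (𝔼 n) ≃ₗᵢ[ℝ] (𝔼 n)) :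
    isometryDet w = (-1) ^ (n - Module.finrank ℝ (fixedSpace w)) := by
  obtain ⟨l, hl, rfl⟩ := exists_rootWord_eq_of_fixedSpace w
  obtain ⟨h₁, h₂⟩ := isometryDet_rootWord l
  rw [h₂ (by omega)]
  congr 1
  omega

/-- The determinant of an orthogonal transformation as an integer sign. -/
def fixedSign (w : (𝔼 n) ≃ₗᵢ[ℝ] (𝔼 n)) : ℤ := (-1) ^ (n - Module.finrank ℝ (fixedSpace w))

theorem fixedSign_one : fixedSign (1 : (𝔼 n) ≃ₗᵢ[ℝ] (𝔼 n)) = 1 := by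
  rw [fixedSign, fixedSpace_one, finrank_top, finrank_euclideanSpace_fin, Nat.sub_self, pow_zero]

theorem fixedSign_mul {s : (𝔼 n) ≃ₗᵢ[ℝ] (𝔼 n)} (hs : IsReflection s) (w : (𝔼 n) ≃ₗᵢ[ℝ] (𝔼 n)) :
    fixedSign (s * w) = -fixedSign w := by
  have hcast : ∀ u : (𝔼 n) ≃ₗᵢ[ℝ] (𝔼 n), ((fixedSign u : ℤ) : ℝ) = isometryDet u := fun u => by
    rw [isometryDet_eq, fixedSign]; push_cast; rfl
  obtain ⟨α, hα, rfl⟩ := hs.exists_rootReflection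
  have hα0 : α ≠ 0 := norm_ne_zero_iff.1 (by rw [hα]; exact one_ne_zero)
  have h : ((fixedSign (rootReflection α * w) : ℤ) : ℝ) = ((-fixedSign w : ℤ) : ℝ) := by
    rw [Int.cast_neg, hcast, hcast, map_mul, isometryDet_rootReflection hα0, neg_one_mul]
  exact_mod_cast h

/-- The signs of the elements fixing a proper intersection subspace pointwise sum to zero. -/
theorem sum_fixedSign_eq_zero {W : Subgroup ((𝔼 n) ≃ₗᵢ[ℝ] (𝔼 n))} [Fintype W]
    {X : Submodule ℝ (𝔼 n)} (hX : X ∈ intLattice W) (hne : X ≠ ⊤) :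
    ∑ w : W, (if X ≤ fixedSpace (w : (𝔼 n) ≃ₗᵢ[ℝ] (𝔼 n)) then
      fixedSign (w : (𝔼 n) ≃ₗᵢ[ℝ] (𝔼 n)) else 0) = 0 := by
  obtain ⟨S, hS, rfl⟩ := hX
  obtain ⟨H, hH⟩ : S.Nonempty := by
    rw [Set.nonempty_iff_ne_empty]
    rintro rfl
    exact hne sInf_empty
  obtain ⟨s, hsW, hs, rfl⟩ := hS hH
  have hXs : sInf S ≤ fixedSpace s := sInf_le hH
  have hiff : ∀ w : (𝔼 n) ≃ₗᵢ[ℝ] (𝔼 n), sInf S ≤ fixedSpace (s * w) ↔ sInf S ≤ fixedSpace w := by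
    refine fun w => forall₂_congr fun x hx => ?_
    have hsx : s x = x := hXs hx
    rw [mem_fixedSpace, mem_fixedSpace, LinearIsometryEquiv.coe_mul, Function.comp_apply]
    exact ⟨fun h => s.injective (h.trans hsx.symm), fun h => by rw [h, hsx]⟩
  refine self_eq_neg.1 ?_
  rw [← Finset.sum_neg_distrib]
  conv_lhs => rw [← Equiv.sum_comp (Equiv.mulLeft (⟨s, hsW⟩ : W))]
  refine Finset.sum_congr rfl fun w _ => ?_
  simp only [Equiv.coe_mulLeft, Subgroup.coe_mul, hiff, fixedSign_mul hs]
  split_ifs <;> simp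

/-- The right-hand side of the Möbius function formula as a sum over the group. -/
theorem signed_card_eq_sum (W : Subgroup ((𝔼 n) ≃ₗᵢ[ℝ] (𝔼 n))) [Fintype W]
    (X : Submodule ℝ (𝔼 n)) :
    (-1) ^ (n - Module.finrank ℝ X) *
        (Nat.card {w : W | fixedSpace (w : (𝔼 n) ≃ₗᵢ[ℝ] (𝔼 n)) = X} : ℤ) =
      ∑ w : W, (if fixedSpace (w : (𝔼 n) ≃ₗᵢ[ℝ] (𝔼 n)) = X then
        fixedSign (w : (𝔼 n) ≃ₗᵢ[ℝ] (𝔼 n)) else 0) := by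
  have h : ∀ w : W, (if fixedSpace (w : (𝔼 n) ≃ₗᵢ[ℝ] (𝔼 n)) = X then
      fixedSign (w : (𝔼 n) ≃ₗᵢ[ℝ] (𝔼 n)) else 0) =
      if fixedSpace (w : (𝔼 n) ≃ₗᵢ[ℝ] (𝔼 n)) = X then
        (-1 : ℤ) ^ (n - Module.finrank ℝ X) else 0 := fun w => by
    split_ifs with h
    · rw [fixedSign, h]
    · rfl
  simp_rw [h]
  rw [← Finset.sum_filter, Finset.sum_const, nsmul_eq_mul, mul_comm, Nat.card_coe_set_eq,
    Set.ncard_eq_toFinset_card', Set.toFinset_ofPred]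

end Euclidean

/-- For a finite real reflection group `W` acting on `V = ℝⁿ`, the Möbius function of
the intersection lattice (ordered by reverse inclusion, with bottom element `V = ⊤`,
characterized by `μ(V,V) = 1` and `∑_{V ≤ Z ≤ X} μ(V,Z) = 0` for `X ≠ V`) satisfies
`μ(V, X) = (−1)^{n − dim X} · #{w ∈ W : V^w = X}`. -/
theorem stmt3 (n : ℕ)
    (W : Subgroup (EuclideanSpace ℝ (Fin n) ≃ₗᵢ[ℝ] EuclideanSpace ℝ (Fin n)))
    [Finite W]
    (hgen : Subgroup.closure {w | w ∈ W ∧ IsReflection w} = W)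
    [Fintype (intLattice W)]
    (μ : intLattice W → ℤ)
    (hμ1 : ∀ X : intLattice W, (X : Submodule ℝ (EuclideanSpace ℝ (Fin n))) = ⊤ → μ X = 1)
    (hμ2 : ∀ X : intLattice W, (X : Submodule ℝ (EuclideanSpace ℝ (Fin n))) ≠ ⊤ →
      ∑ Z : intLattice W,
        (if (X : Submodule ℝ (EuclideanSpace ℝ (Fin n))) ≤ Z then μ Z else 0) = 0) :
    ∀ X : intLattice W,
      μ X = (-1) ^ (n - Module.finrank ℝ (X : Submodule ℝ (EuclideanSpace ℝ (Fin n)))) *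
        Nat.card {w : W |
          fixedSpace (w : EuclideanSpace ℝ (Fin n) ≃ₗᵢ[ℝ] EuclideanSpace ℝ (Fin n)) = X} := by
  have : Fintype W := Fintype.ofFinite W
  have hstep : ∀ X : intLattice W, (X : Submodule ℝ (EuclideanSpace ℝ (Fin n))) ≠ ⊤ →
      ∑ Z : intLattice W, (if (X : Submodule ℝ (EuclideanSpace ℝ (Fin n))) ≤ Z then
        ∑ w : W, (if fixedSpace (w : EuclideanSpace ℝ (Fin n) ≃ₗᵢ[ℝ] EuclideanSpace ℝ (Fin n)) = Z
          then fixedSign (w : EuclideanSpace ℝ (Fin n) ≃ₗᵢ[ℝ] EuclideanSpace ℝ (Fin n)) else 0)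
        else 0) = 0 := by
    intro X hX
    refine Eq.trans ?_ (sum_fixedSign_eq_zero X.2 hX)
    rw [← Finset.sum_filter, Finset.sum_comm]
    refine Finset.sum_congr rfl fun w _ => ?_
    rw [Finset.sum_filter, Finset.sum_eq_single ⟨_, fixedSpace_mem_intLattice hgen w.2⟩]
    · simp
    · intro Z _ hZ
      have : fixedSpace (w : EuclideanSpace ℝ (Fin n) ≃ₗᵢ[ℝ] EuclideanSpace ℝ (Fin n)) ≠ Z :=
        fun h => hZ (Subtype.ext h.symm)
      simp [this]
    · simp
  intro X
  rw [signed_card_eq_sum]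
  induction X using WellFoundedGT.induction with
  | _ X ih =>
  by_cases hX : (X : Submodule ℝ (EuclideanSpace ℝ (Fin n))) = ⊤
  · rw [hμ1 X hX, Finset.sum_eq_single 1]
    · simp [hX, fixedSign_one, fixedSpace_one]
    · intro w _ hw
      rw [hX, if_neg fun h => hw (Subtype.ext (fixedSpace_eq_top_iff.1 h))]
    · simp
  · have h := (hμ2 X hX).trans (hstep X hX).symm
    rw [← Finset.add_sum_erase _ _ (Finset.mem_univ X),
      ← Finset.add_sum_erase (a := X) _ _ (Finset.mem_univ X), if_pos le_rfl, if_pos le_rfl] at h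
    refine add_right_cancel (h.trans (congrArg _ (Finset.sum_congr rfl fun Z hZ => ?_)).symm)
    split_ifs with hle
    · exact ih Z (lt_of_le_of_ne hle (Finset.ne_of_mem_erase hZ).symm)
    · rfl

end
end

section
/- Let W be a finite complex reflection group acting on V = ℂⁿ with intersection lattice L of its reflection arrangement. Then for every X in L, μ(V, X) = ∑_{w ∈ W : V^w = X} det(w), where μ is the Möbius function of L. -/
open scoped Classical

noncomputable section

/-- The fixed subspace `V^w` of a linear automorphism of `ℂⁿ`. -/
def cFixedSpace {n : ℕ} (w : (Fin n → ℂ) ≃ₗ[ℂ] (Fin n → ℂ)) : Submodule ℂ (Fin n → ℂ) :=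
  LinearMap.eqLocus (w : (Fin n → ℂ) →ₗ[ℂ] (Fin n → ℂ)) LinearMap.id

/-- A pseudo-reflection: a nonidentity element whose fixed space is a hyperplane. -/
def IsPseudoReflection {n : ℕ} (w : (Fin n → ℂ) ≃ₗ[ℂ] (Fin n → ℂ)) : Prop :=
  w ≠ 1 ∧ Module.finrank ℂ (cFixedSpace w) = n - 1

/-- The reflecting hyperplanes of a group of linear automorphisms of `ℂⁿ`. -/
def cReflHyperplanes {n : ℕ} (W : Subgroup ((Fin n → ℂ) ≃ₗ[ℂ] (Fin n → ℂ))) :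
    Set (Submodule ℂ (Fin n → ℂ)) :=
  {H | ∃ w ∈ W, IsPseudoReflection w ∧ cFixedSpace w = H}

/-- The intersection lattice: all intersections of collections of reflecting hyperplanes
(the empty intersection being `V = ⊤`). -/
def cIntLattice {n : ℕ} (W : Subgroup ((Fin n → ℂ) ≃ₗ[ℂ] (Fin n → ℂ))) :
    Set (Submodule ℂ (Fin n → ℂ)) :=
  {X | ∃ s : Set (Submodule ℂ (Fin n → ℂ)), s ⊆ cReflHyperplanes W ∧ X = sInf s}

open MvPolynomial

section PolynomialAction

variable {n : ℕ}

/-- The action of a linear automorphism on polynomials, by `(g • f)(x) = f(g⁻¹ x)`. -/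
def polyAct (g : (Fin n → ℂ) ≃ₗ[ℂ] (Fin n → ℂ)) :
    MvPolynomial (Fin n) ℂ →ₐ[ℂ] MvPolynomial (Fin n) ℂ :=
  aeval fun i => ∑ j, C (g⁻¹ (Pi.single j 1) i) * X j

lemma eval_polyAct (g : (Fin n → ℂ) ≃ₗ[ℂ] (Fin n → ℂ)) (x : Fin n → ℂ)
    (f : MvPolynomial (Fin n) ℂ) : eval x (polyAct g f) = eval (g⁻¹ x) f := by
  induction f using MvPolynomial.induction_on with
  | C a => simp [polyAct]
  | add p q hp hq => simp [hp, hq]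
  | mul_X p i hp =>
    rw [map_mul, map_mul, hp, map_mul, eval_X]
    congr 1
    have hx : x = ∑ j, x j • Pi.single j (1 : ℂ) := by
      ext k; simp [Finset.sum_apply, Pi.single_apply]
    conv_rhs => rw [hx]
    simp [polyAct, map_sum, Finset.sum_apply, mul_comm]

instance polyAction : MulSemiringAction ((Fin n → ℂ) ≃ₗ[ℂ] (Fin n → ℂ))
    (MvPolynomial (Fin n) ℂ) where
  smul g f := polyAct g f
  one_smul f := by
    apply MvPolynomial.funext
    intro x
    change eval x (polyAct 1 f) = _
    simp [eval_polyAct]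
  mul_smul g h f := by
    apply MvPolynomial.funext
    intro x
    change eval x (polyAct (g * h) f) = eval x (polyAct g (polyAct h f))
    simp [eval_polyAct, mul_inv_rev]
  smul_zero g := map_zero (polyAct g)
  smul_add g := map_add (polyAct g)
  smul_one g := map_one (polyAct g)
  smul_mul g := map_mul (polyAct g)

lemma eval_smul_poly (g : (Fin n → ℂ) ≃ₗ[ℂ] (Fin n → ℂ)) (x : Fin n → ℂ)
    (f : MvPolynomial (Fin n) ℂ) : eval x (g • f) = eval (g⁻¹ x) f :=
  eval_polyAct g x f

lemma smul_poly_C (g : (Fin n → ℂ) ≃ₗ[ℂ] (Fin n → ℂ)) (a : ℂ) :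
    g • (C a : MvPolynomial (Fin n) ℂ) = C a :=
  (polyAct g).commutes a

instance : SMulCommClass ((Fin n → ℂ) ≃ₗ[ℂ] (Fin n → ℂ)) ℂ (MvPolynomial (Fin n) ℂ) where
  smul_comm g c f := map_smul (polyAct g) c f

lemma totalDegree_smul_poly_le (g : (Fin n → ℂ) ≃ₗ[ℂ] (Fin n → ℂ))
    (f : MvPolynomial (Fin n) ℂ) : (g • f).totalDegree ≤ f.totalDegree := by
  have hX (i : Fin n) :
      (∑ j, C (g⁻¹ (Pi.single j 1) i) * X j : MvPolynomial (Fin n) ℂ).totalDegree ≤ 1 := by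
    refine (totalDegree_finsetSum _ _).trans (Finset.sup_le fun j _ => ?_)
    refine (totalDegree_mul _ _).trans ?_
    simp
  change (polyAct g f).totalDegree ≤ _
  rw [polyAct, aeval_def, eval₂_eq]
  refine (totalDegree_finsetSum _ _).trans (Finset.sup_le fun d hd => ?_)
  refine (totalDegree_mul _ _).trans ?_
  rw [algebraMap_eq, totalDegree_C, zero_add]
  refine (totalDegree_finsetProd _ _).trans ?_
  refine le_trans (Finset.sum_le_sum fun i _ => ?_) (le_totalDegree hd)
  refine (totalDegree_pow _ _).trans ?_
  exact (Nat.mul_le_mul_left _ (hX i)).trans (mul_one _).le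

lemma smul_poly_injective {g h : (Fin n → ℂ) ≃ₗ[ℂ] (Fin n → ℂ)}
    (H : ∀ i, g • (X i : MvPolynomial (Fin n) ℂ) = h • X i) : g = h := by
  rw [← inv_inj]
  ext1 x
  ext1 i
  simpa [eval_smul_poly] using congrArg (eval x) (H i)

end PolynomialAction

section Reflections

variable {n : ℕ}

lemma mem_cFixedSpace {w : (Fin n → ℂ) ≃ₗ[ℂ] (Fin n → ℂ)} {x : Fin n → ℂ} :
    x ∈ cFixedSpace w ↔ w x = x := by
  simp [cFixedSpace, LinearMap.mem_eqLocus]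

lemma IsPseudoReflection.exists_transvection {s : (Fin n → ℂ) ≃ₗ[ℂ] (Fin n → ℂ)}
    (hs : IsPseudoReflection s) : ∃ (c : Module.Dual ℂ (Fin n → ℂ)) (v : Fin n → ℂ),
      c ≠ 0 ∧ v ≠ 0 ∧ ∀ x, s x = x + c x • v := by
  set T : (Fin n → ℂ) →ₗ[ℂ] (Fin n → ℂ) :=
    (s : (Fin n → ℂ) →ₗ[ℂ] (Fin n → ℂ)) - LinearMap.id
  have hTx (x) : T x = s x - x := by simp [T]
  have hker : LinearMap.ker T = cFixedSpace s := by
    ext x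
    rw [LinearMap.mem_ker, hTx, mem_cFixedSpace, sub_eq_zero]
  have hT0 : T ≠ 0 := by
    intro h
    apply hs.1
    refine LinearEquiv.ext fun x => ?_
    simpa [hTx, sub_eq_zero] using LinearMap.congr_fun h x
  have hrank := LinearMap.finrank_range_add_finrank_ker T
  rw [hker, hs.2, Module.finrank_fin_fun] at hrank
  have hn : n ≠ 0 := by
    rintro rfl
    exact hT0 (LinearMap.ext fun x => Subsingleton.elim _ _)
  have h1 : Module.finrank ℂ (LinearMap.range T) = 1 := by omega
  obtain ⟨⟨v, hv⟩, hv0, hspan⟩ := finrank_eq_one_iff'.1 h1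
  have hv0' : v ≠ 0 := fun h => hv0 (Subtype.ext h)
  obtain ⟨i, hi⟩ := Function.ne_iff.1 hv0'
  have hi : v i ≠ 0 := hi
  have hc (x) : T x = (T x i / v i) • v := by
    obtain ⟨a, ha⟩ := hspan ⟨T x, LinearMap.mem_range_self T x⟩
    have ha : a • v = T x := congrArg Subtype.val ha
    rw [← ha, Pi.smul_apply, smul_eq_mul, mul_div_cancel_right₀ _ hi]
  refine ⟨(v i)⁻¹ • (LinearMap.proj i ∘ₗ T), v, ?_, hv0', fun x => ?_⟩
  · intro h
    apply hT0
    refine LinearMap.ext fun x => ?_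
    have := LinearMap.congr_fun h x
    simp only [LinearMap.smul_apply, LinearMap.comp_apply, LinearMap.proj_apply, smul_eq_mul,
      LinearMap.zero_apply] at this
    rw [hc, div_eq_inv_mul, this, zero_smul, LinearMap.zero_apply]
  · have := hc x
    rw [div_eq_inv_mul] at this
    simp only [LinearMap.smul_apply, LinearMap.comp_apply, LinearMap.proj_apply, smul_eq_mul]
    rw [← this, hTx, add_sub_cancel]

lemma IsPseudoReflection.det_ne_one {s : (Fin n → ℂ) ≃ₗ[ℂ] (Fin n → ℂ)}
    (hs : IsPseudoReflection s) (hfin : IsOfFinOrder s) :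
    LinearMap.det (s : (Fin n → ℂ) →ₗ[ℂ] (Fin n → ℂ)) ≠ 1 := by
  obtain ⟨c, v, hc, hv, h⟩ := hs.exists_transvection
  have hs' : (s : (Fin n → ℂ) →ₗ[ℂ] (Fin n → ℂ)) = LinearMap.transvection c v :=
    LinearMap.ext h
  rw [hs', LinearMap.transvection.det]
  intro hcv
  have hcv : c v = 0 := by simpa using hcv
  have hpow (k : ℕ) (x) : (s ^ k) x = x + (k : ℂ) • c x • v := by
    induction k with
    | zero => simp
    | succ k ih =>
      rw [pow_succ', LinearEquiv.mul_apply, ih, h]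
      simp only [map_add, map_smul, hcv, smul_eq_mul, mul_zero, add_zero]
      push_cast
      module
  obtain ⟨k, hk, hk1⟩ := isOfFinOrder_iff_pow_eq_one.1 hfin
  apply hc
  refine LinearMap.ext fun x => ?_
  have := hpow k x
  rw [hk1] at this
  simpa [hk.ne', hv] using this

lemma IsPseudoReflection.exists_dvd_sub_smul {s : (Fin n → ℂ) ≃ₗ[ℂ] (Fin n → ℂ)}
    (hs : IsPseudoReflection s) : ∃ α : MvPolynomial (Fin n) ℂ, α ≠ 0 ∧ α.totalDegree ≠ 0 ∧
      ∀ f : MvPolynomial (Fin n) ℂ, α ∣ f - s • f := by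
  obtain ⟨c, v, hc, hv, h⟩ := hs.exists_transvection
  set α : MvPolynomial (Fin n) ℂ := ∑ j, C (c (s⁻¹ (Pi.single j 1))) * X j with hα
  have hev (x) : eval x α = c (s⁻¹ x) := by
    have hx : x = ∑ j, x j • Pi.single j (1 : ℂ) := by
      ext k; simp [Finset.sum_apply, Pi.single_apply]
    conv_rhs => rw [hx]
    simp [hα, map_sum, mul_comm]
  have hne : α ≠ 0 := by
    intro h0
    apply hc
    refine LinearMap.ext fun x => ?_
    have := hev (s x)
    simpa [h0] using this.symm
  refine ⟨α, hne, ?_, fun f => ?_⟩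
  · intro h0
    rw [totalDegree_eq_zero_iff_eq_C] at h0
    apply hne
    have := hev 0
    rw [h0, eval_C, map_zero, map_zero] at this
    rw [h0, this, C_0]
  · induction f using MvPolynomial.induction_on with
    | C a => simp [smul_poly_C]
    | add p q hp hq =>
      rw [smul_add, add_sub_add_comm]
      exact dvd_add hp hq
    | mul_X p i hp =>
      have hX : (X i : MvPolynomial (Fin n) ℂ) - s • X i = α * C (v i) := by
        apply MvPolynomial.funext
        intro x
        have := congrFun (h (s⁻¹ x)) i
        have hx : s (s⁻¹ x) = x := by rw [← LinearEquiv.mul_apply, mul_inv_cancel]; rfl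
        rw [hx] at this
        simp only [map_sub, map_mul, eval_smul_poly, hev, eval_X, eval_C]
        rw [this]
        simp
      have : p * X i - s • (p * X i) = p * (X i - s • X i) + (p - s • p) * s • X i := by
        rw [smul_mul']; ring
      rw [this, hX]
      exact dvd_add ((dvd_mul_right _ _).mul_left _) (hp.mul_right _)

/-- Divided differences lower the degree. -/
lemma IsPseudoReflection.exists_divided_difference {s : (Fin n → ℂ) ≃ₗ[ℂ] (Fin n → ℂ)}
    (hs : IsPseudoReflection s) : ∃ α : MvPolynomial (Fin n) ℂ, α ≠ 0 ∧
      ∃ Δ : MvPolynomial (Fin n) ℂ → MvPolynomial (Fin n) ℂ, ∀ f, f - s • f = α * Δ f ∧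
        (Δ f = 0 ∨ (Δ f).totalDegree < f.totalDegree) := by
  obtain ⟨α, hα, hdeg, hdvd⟩ := hs.exists_dvd_sub_smul
  choose Δ hΔ using hdvd
  refine ⟨α, hα, Δ, fun f => ⟨hΔ f, or_iff_not_imp_left.2 fun h0 => ?_⟩⟩
  have h1 := totalDegree_mul_of_isDomain hα h0
  have h2 := totalDegree_sub f (s • f)
  have h3 := totalDegree_smul_poly_le s f
  rw [hΔ f, h1, max_eq_left h3] at h2
  omega

end Reflections

section Invariants

variable {n : ℕ} (W : Subgroup ((Fin n → ℂ) ≃ₗ[ℂ] (Fin n → ℂ)))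

/-- The algebra of polynomials invariant under `W`. -/
abbrev polyInvariants : Subalgebra ℂ (MvPolynomial (Fin n) ℂ) :=
  FixedPoints.subalgebra ℂ (MvPolynomial (Fin n) ℂ) W

/-- The ideal generated by the invariants vanishing at the origin. -/
def hilbertIdeal : Ideal (MvPolynomial (Fin n) ℂ) :=
  Ideal.span {f | f ∈ polyInvariants W ∧ eval 0 f = 0}

variable {W}

lemma smul_polyInvariants (w : W) (r : polyInvariants W) :
    w • (r : MvPolynomial (Fin n) ℂ) = r := r.2 w

lemma smul_mem_hilbertIdeal (w : W) {f : MvPolynomial (Fin n) ℂ} (hf : f ∈ hilbertIdeal W) :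
    w • f ∈ hilbertIdeal W := by
  induction hf using Submodule.span_induction with
  | mem f hf => rw [hf.1 w]; exact Ideal.subset_span hf
  | zero => rw [smul_zero]; exact zero_mem _
  | add f g _ _ hf hg => rw [smul_add]; exact add_mem hf hg
  | smul a f _ hf => rw [smul_eq_mul, smul_mul']; exact Ideal.mul_mem_left _ _ hf

lemma sub_C_mem_hilbertIdeal (r : polyInvariants W) :
    (r : MvPolynomial (Fin n) ℂ) - C (eval 0 (r : MvPolynomial (Fin n) ℂ)) ∈ hilbertIdeal W := by
  refine Ideal.subset_span ⟨sub_mem r.2 ?_, by simp⟩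
  exact (polyInvariants W).algebraMap_mem _

/-- The sum of the `W`-translates of a polynomial. -/
def invTrace [Fintype W] (f : MvPolynomial (Fin n) ℂ) : polyInvariants W :=
  ⟨∑ w : W, w • f, fun g => by
    rw [Finset.smul_sum]
    simp_rw [← mul_smul]
    exact Fintype.sum_equiv (Equiv.mulLeft g) _ _ fun _ => rfl⟩

lemma sum_mul_invTrace_eq_zero [Fintype W] {ι : Type*} [Fintype ι] (r : ι → polyInvariants W)
    (p : ι → MvPolynomial (Fin n) ℂ) (h : ∑ i, (r i : MvPolynomial (Fin n) ℂ) * p i = 0) :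
    ∑ i, r i * invTrace (p i) = 0 := by
  apply Subtype.ext
  simp only [invTrace, AddSubmonoidClass.coe_finsetSum, MulMemClass.coe_mul,
    ZeroMemClass.coe_zero, Finset.mul_sum]
  rw [Finset.sum_comm]
  refine Finset.sum_eq_zero fun w _ => ?_
  have := congrArg (w • ·) h
  simpa [Finset.smul_sum, smul_mul', smul_polyInvariants] using this

lemma mem_hilbertIdeal_of_forall_sub_smul_mem [Fintype W] {f : MvPolynomial (Fin n) ℂ}
    (h : ∀ w : W, f - w • f ∈ hilbertIdeal W)
    (h0 : eval 0 (invTrace f : polyInvariants W).1 = 0) : f ∈ hilbertIdeal W := by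
  have h1 : (invTrace f : polyInvariants W).1 ∈ hilbertIdeal W := by
    have := sub_C_mem_hilbertIdeal (invTrace f : polyInvariants W)
    rwa [h0, C_0, sub_zero] at this
  have h2 : ∑ w : W, (f - w • f) ∈ hilbertIdeal W := sum_mem fun w _ => h w
  have h3 : (Fintype.card W : MvPolynomial (Fin n) ℂ) * f ∈ hilbertIdeal W := by
    have := add_mem h2 h1
    simpa [Finset.sum_sub_distrib, invTrace] using this
  have hcard : C (Fintype.card W : ℂ)⁻¹ * (Fintype.card W : MvPolynomial (Fin n) ℂ) = 1 := by
    rw [← map_natCast (C : ℂ →+* MvPolynomial (Fin n) ℂ), ← C_mul, inv_mul_cancel₀, C_1]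
    exact_mod_cast Fintype.card_ne_zero
  have := Ideal.mul_mem_left _ (C (Fintype.card W : ℂ)⁻¹) h3
  rwa [← mul_assoc, hcard, one_mul] at this

lemma sub_smul_mem_hilbertIdeal
    (hgen : Subgroup.closure {w | w ∈ W ∧ IsPseudoReflection w} = W)
    {f : MvPolynomial (Fin n) ℂ}
    (h : ∀ s ∈ W, IsPseudoReflection s → f - s • f ∈ hilbertIdeal W) (w : W) :
    f - w • f ∈ hilbertIdeal W := by
  have key : ∀ w ∈ Subgroup.closure {w | w ∈ W ∧ IsPseudoReflection w},
      f - w • f ∈ hilbertIdeal W := by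
    intro w hw
    induction hw using Subgroup.closure_induction with
    | mem s hs => exact h s hs.1 hs.2
    | one => simp
    | mul a b ha hb iha ihb =>
      rw [hgen] at ha
      have : f - (a * b) • f = (f - a • f) + a • (f - b • f) := by
        rw [smul_sub, mul_smul]; ring
      rw [this]
      exact add_mem iha (smul_mem_hilbertIdeal ⟨a, ha⟩ ihb)
    | inv a ha iha =>
      rw [hgen] at ha
      have : f - a⁻¹ • f = -(a⁻¹ • (f - a • f)) := by
        rw [smul_sub, inv_smul_smul]; ring
      rw [this]
      exact neg_mem (smul_mem_hilbertIdeal ⟨a⁻¹, inv_mem ha⟩ iha)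
  exact key w (by rw [hgen]; exact w.2)

/-- Chevalley's lemma on relations with invariant coefficients. -/
lemma mem_hilbertIdeal_of_relation [Fintype W]
    (hgen : Subgroup.closure {w | w ∈ W ∧ IsPseudoReflection w} = W) {m : ℕ}
    (r : Fin (m + 1) → polyInvariants W)
    (hr : ∀ (t : polyInvariants W) (c : Fin m → polyInvariants W),
      t * r 0 = ∑ i, c i * r i.succ → eval 0 (t : MvPolynomial (Fin n) ℂ) = 0)
    (p : Fin (m + 1) → MvPolynomial (Fin n) ℂ)
    (h : ∑ i, (r i : MvPolynomial (Fin n) ℂ) * p i = 0) : p 0 ∈ hilbertIdeal W := by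
  induction hd : (p 0).totalDegree using Nat.strong_induction_on generalizing p with
  | _ d ih =>
    apply mem_hilbertIdeal_of_forall_sub_smul_mem
    · apply sub_smul_mem_hilbertIdeal hgen
      intro s hsW hs
      obtain ⟨α, hα, Δ, hΔ⟩ := hs.exists_divided_difference
      rw [(hΔ _).1]
      apply Ideal.mul_mem_left
      rcases (hΔ (p 0)).2 with h0 | hlt
      · rw [h0]; exact zero_mem _
      · refine ih _ (hd ▸ hlt) (fun i => Δ (p i)) ?_ rfl
        have h1 : ∑ i, (r i : MvPolynomial (Fin n) ℂ) * (p i - s • p i) = 0 := by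
          have := congrArg ((⟨s, hsW⟩ : W) • ·) h
          simp only [Finset.smul_sum, smul_mul', smul_polyInvariants, smul_zero] at this
          simp only [mul_sub, Finset.sum_sub_distrib, h, zero_sub, neg_eq_zero]
          exact this
        simp only [(hΔ _).1, mul_left_comm _ α, ← Finset.mul_sum] at h1
        exact (mul_eq_zero.1 h1).resolve_left hα
    · apply hr _ fun i => -invTrace (p i.succ)
      have := sum_mul_invTrace_eq_zero r p h
      rw [Fin.sum_univ_succ] at this
      rw [mul_comm, eq_neg_of_add_eq_zero_left this, ← Finset.sum_neg_distrib]
      exact Finset.sum_congr rfl fun i _ => by ring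

lemma eq_zero_of_sum_mul_eq_zero [Fintype W]
    (hgen : Subgroup.closure {w | w ∈ W ∧ IsPseudoReflection w} = W) {m : ℕ}
    (p : Fin m → MvPolynomial (Fin n) ℂ)
    (hp : ∀ c : Fin m → ℂ, ∑ i, C (c i) * p i ∈ hilbertIdeal W → c = 0)
    (r : Fin m → polyInvariants W)
    (h : ∑ i, (r i : MvPolynomial (Fin n) ℂ) * p i = 0) : r = 0 := by
  induction m with
  | zero => exact Subsingleton.elim _ _
  | succ m ih =>
    by_cases hr : ∀ (t : polyInvariants W) (c : Fin m → polyInvariants W),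
      t * r 0 = ∑ i, c i * r i.succ → eval 0 (t : MvPolynomial (Fin n) ℂ) = 0
    · have h0 := mem_hilbertIdeal_of_relation hgen r hr p h
      have := congrFun (hp (Pi.single 0 1) (by
        rw [Finset.sum_eq_single 0] <;> simp +contextual [h0])) 0
      simp at this
    · push Not at hr
      obtain ⟨t, c, htc, ht0⟩ := hr
      have htne : t ≠ 0 := by rintro rfl; simp at ht0
      have hsucc := ih (fun i => (t : MvPolynomial (Fin n) ℂ) * p i.succ + c i * p 0) ?_
        (fun i => r i.succ) ?_
      · have hr0 : r 0 = 0 := by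
          have : ∀ i : Fin m, r i.succ = 0 := congrFun hsucc
          simp only [this, mul_zero, Finset.sum_const_zero] at htc
          exact (mul_eq_zero.1 htc).resolve_left htne
        funext i
        exact Fin.cases hr0 (congrFun hsucc) i
      · intro d hd
        set τ := eval 0 (t : MvPolynomial (Fin n) ℂ)
        have key := hp (Fin.cons (∑ i, d i * eval 0 (c i : MvPolynomial (Fin n) ℂ))
          fun i => d i * τ) ?_
        · funext i
          have := congrFun key i.succ
          simpa [ht0] using this
        · have h1 : ∑ i, C (d i) * ((t : MvPolynomial (Fin n) ℂ) - C τ) * p i.succ +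
              ∑ i, C (d i) * ((c i : MvPolynomial (Fin n) ℂ) -
                C (eval 0 (c i : MvPolynomial (Fin n) ℂ))) * p 0 ∈ hilbertIdeal W :=
            add_mem
              (sum_mem fun i _ => Ideal.mul_mem_right _ _
                (Ideal.mul_mem_left _ _ (sub_C_mem_hilbertIdeal _)))
              (sum_mem fun i _ => Ideal.mul_mem_right _ _
                (Ideal.mul_mem_left _ _ (sub_C_mem_hilbertIdeal _)))
          convert sub_mem hd h1 using 1
          rw [Fin.sum_univ_succ]
          simp only [Fin.cons_zero, Fin.cons_succ, map_sum, C_mul, Finset.sum_mul,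
            ← Finset.sum_add_distrib, ← Finset.sum_sub_distrib]
          exact Finset.sum_congr rfl fun i _ => by ring
      · have htc' := congrArg (Subtype.val) htc
        simp only [AddSubmonoidClass.coe_finsetSum, MulMemClass.coe_mul] at htc'
        rw [Fin.sum_univ_succ] at h
        have h2 := congrArg ((t : MvPolynomial (Fin n) ℂ) * ·) h
        simp only [mul_add, mul_zero, ← mul_assoc, htc', Finset.sum_mul, Finset.mul_sum] at h2
        rw [← h2, ← Finset.sum_add_distrib]
        exact Finset.sum_congr rfl fun i _ => by ring

end Invariants

section Coinvariants

variable {n : ℕ} {W : Subgroup ((Fin n → ℂ) ≃ₗ[ℂ] (Fin n → ℂ))}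

lemma eq_zero_of_forall_invTrace_mul_eq_zero [Fintype W] {f : MvPolynomial (Fin n) ℂ}
    (h : ∀ a, (invTrace (a * f) : polyInvariants W) = 0) : f = 0 := by
  let χ : W → (MvPolynomial (Fin n) ℂ →* MvPolynomial (Fin n) ℂ) := fun w =>
    (MulSemiringAction.toRingHom W (MvPolynomial (Fin n) ℂ) w : _ →* _)
  have hχ : Function.Injective χ := fun w w' hw =>
    Subtype.ext (smul_poly_injective fun i => DFunLike.congr_fun hw (X i))
  have hli := (linearIndependent_monoidHom (MvPolynomial (Fin n) ℂ)
    (MvPolynomial (Fin n) ℂ)).comp χ hχ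
  have h1 := Fintype.linearIndependent_iff.1 hli (fun w => w • f) ?_ 1
  · simpa using h1
  · funext a
    have := congrArg Subtype.val (h a)
    simp only [invTrace, smul_mul', ZeroMemClass.coe_zero] at this
    simp only [Finset.sum_apply, Pi.smul_apply, smul_eq_mul, Pi.zero_apply, Function.comp_apply]
    rw [← this]
    exact Finset.sum_congr rfl fun w _ => mul_comm _ _

lemma card_le_of_forall_sum_mul_eq_zero [Fintype W] {m : ℕ}
    (p : Fin m → MvPolynomial (Fin n) ℂ)
    (h : ∀ r : Fin m → polyInvariants W,
      ∑ i, (r i : MvPolynomial (Fin n) ℂ) * p i = 0 → r = 0) : m ≤ Fintype.card W := by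
  let E : Matrix W (Fin m) (MvPolynomial (Fin n) ℂ) := Matrix.of fun w j => w • p j
  have := card_le_of_injective (MvPolynomial (Fin n) ℂ) E.mulVecLin ?_
  · simpa using this
  rw [← LinearMap.ker_eq_bot, LinearMap.ker_eq_bot']
  intro s hs
  have hs (w : W) : ∑ j, (w • p j) * s j = 0 := congrFun hs w
  funext j
  refine eq_zero_of_forall_invTrace_mul_eq_zero (W := W) fun a => ?_
  refine congrFun (h (fun j => invTrace (a * s j)) ?_) j
  simp only [invTrace, Finset.sum_mul]
  rw [Finset.sum_comm]
  refine Finset.sum_eq_zero fun w _ => ?_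
  have h1 := congrArg (w • ·) (hs w⁻¹)
  simp only [Finset.smul_sum, smul_mul', smul_inv_smul, smul_zero] at h1
  have h2 := congrArg ((w • a) * ·) h1
  simp only [Finset.mul_sum, mul_zero] at h2
  rw [← h2]
  exact Finset.sum_congr rfl fun j _ => by rw [smul_mul']; ring

lemma rank_coinvariants_le [Fintype W]
    (hgen : Subgroup.closure {w | w ∈ W ∧ IsPseudoReflection w} = W) :
    Module.rank ℂ (MvPolynomial (Fin n) ℂ ⧸ hilbertIdeal W) ≤ Fintype.card W := by
  refine rank_le fun s hs => ?_
  let σ := s.equivFin.symm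
  choose p hp using fun i => Ideal.Quotient.mk_surjective (σ i).1
  refine card_le_of_forall_sum_mul_eq_zero p (eq_zero_of_sum_mul_eq_zero hgen p fun c hc => ?_)
  have hli := Fintype.linearIndependent_iff.1 (hs.comp σ σ.injective) c ?_
  · exact funext hli
  · rw [← Ideal.Quotient.eq_zero_iff_mem, map_sum] at hc
    rw [← hc]
    refine Finset.sum_congr rfl fun i _ => ?_
    rw [C_mul']
    exact congrArg (c i • ·) (hp i).symm

lemma finite_polyInvariants [Fintype W] :
    Module.Finite (polyInvariants W) (MvPolynomial (Fin n) ℂ) := by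
  have : Algebra.IsInvariant (polyInvariants W) (MvPolynomial (Fin n) ℂ) W :=
    ⟨fun f hf => ⟨⟨f, hf⟩, rfl⟩⟩
  have := Algebra.IsInvariant.isIntegral (polyInvariants W) (MvPolynomial (Fin n) ℂ) W
  have := Algebra.FiniteType.of_restrictScalars_finiteType ℂ (polyInvariants W)
    (MvPolynomial (Fin n) ℂ)
  exact Algebra.IsIntegral.finite

lemma exists_coinvariant_generators [Fintype W]
    (hgen : Subgroup.closure {w | w ∈ W ∧ IsPseudoReflection w} = W) :
    ∃ e : Fin (Fintype.card W) → MvPolynomial (Fin n) ℂ,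
      ∀ f, ∃ c : Fin (Fintype.card W) → ℂ, f - ∑ j, C (c j) * e j ∈ hilbertIdeal W := by
  have hrank := rank_coinvariants_le hgen
  have : Module.Finite ℂ (MvPolynomial (Fin n) ℂ ⧸ hilbertIdeal W) :=
    Module.rank_lt_aleph0_iff.1 (hrank.trans_lt (Cardinal.natCast_lt_aleph0))
  have hfr : Module.finrank ℂ (MvPolynomial (Fin n) ℂ ⧸ hilbertIdeal W) ≤ Fintype.card W := by
    rw [← Module.finrank_eq_rank] at hrank
    exact_mod_cast hrank
  let b := Module.finBasis ℂ (MvPolynomial (Fin n) ℂ ⧸ hilbertIdeal W)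
  choose p hp using fun i => Ideal.Quotient.mk_surjective (b i)
  let ι := Fin.castLEEmb hfr
  refine ⟨Function.extend ι p 0, fun f => ?_⟩
  refine ⟨Function.extend ι (b.repr (Ideal.Quotient.mk _ f)) 0, ?_⟩
  rw [← Ideal.Quotient.eq_zero_iff_mem, map_sub, sub_eq_zero]
  conv_lhs => rw [← b.sum_repr (Ideal.Quotient.mk _ f)]
  rw [map_sum]
  refine Finset.sum_of_injOn ι ι.injective.injOn (by simp) ?_ ?_
  · intro j _ hj
    have hj : ¬ ∃ i, ι i = j := by simpa using hj
    simp [Function.extend_apply' _ _ _ hj]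
  · intro i _
    rw [ι.injective.extend_apply, ι.injective.extend_apply, C_mul']
    exact congrArg (b.repr (Ideal.Quotient.mk _ f) i • ·) (hp i).symm

/-- A form of Nakayama's lemma for generators modulo an extended ideal. -/
lemma exists_smul_mem_span_of_forall_sub_mem_map {R S : Type*} [CommRing R] [CommRing S]
    [Algebra R S] [Module.Finite R S] (𝔪 : Ideal R) (N : Submodule R S)
    (h : ∀ f : S, ∃ g ∈ N, f - g ∈ 𝔪.map (algebraMap R S)) :
    ∃ t : R, t - 1 ∈ 𝔪 ∧ ∀ f : S, t • f ∈ N := by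
  obtain ⟨t, ht, htN⟩ := Submodule.exists_sub_one_mem_and_smul_eq_zero_of_fg_of_le_smul 𝔪
    (⊤ : Submodule R (S ⧸ N)) Module.Finite.fg_top (by
      intro y _
      obtain ⟨f, rfl⟩ := N.mkQ_surjective y
      obtain ⟨g, hg, hfg⟩ := h f
      have h1 : N.mkQ f = N.mkQ (f - g) := by
        rw [map_sub, eq_comm, sub_eq_self, N.mkQ_apply, Submodule.Quotient.mk_eq_zero]
        exact hg
      rw [h1]
      have h2 : f - g ∈ 𝔪 • (⊤ : Submodule R S) := by
        rw [Ideal.smul_top_eq_map]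
        exact hfg
      have h3 := Submodule.mem_map_of_mem (f := N.mkQ) h2
      rw [Submodule.map_smul''] at h3
      exact Submodule.smul_mono le_rfl le_top h3)
  refine ⟨t, ht, fun f => ?_⟩
  have h1 := htN (N.mkQ f) trivial
  rwa [← map_smul, N.mkQ_apply, Submodule.Quotient.mk_eq_zero] at h1

/-- Near the origin, the polynomial ring is generated by `|W|` elements over the invariants. -/
lemma exists_local_generators [Fintype W]
    (hgen : Subgroup.closure {w | w ∈ W ∧ IsPseudoReflection w} = W) :
    ∃ (t : polyInvariants W) (e : Fin (Fintype.card W) → MvPolynomial (Fin n) ℂ),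
      eval 0 (t : MvPolynomial (Fin n) ℂ) ≠ 0 ∧
      ∀ f : MvPolynomial (Fin n) ℂ, ∃ r : Fin (Fintype.card W) → polyInvariants W,
        t * f = ∑ j, (r j : MvPolynomial (Fin n) ℂ) * e j := by
  obtain ⟨e, he⟩ := exists_coinvariant_generators hgen
  have := finite_polyInvariants (W := W)
  let 𝔪 : Ideal (polyInvariants W) :=
    RingHom.ker ((eval (0 : Fin n → ℂ)).comp (algebraMap (polyInvariants W) _))
  have hI : hilbertIdeal W ≤ 𝔪.map (algebraMap _ (MvPolynomial (Fin n) ℂ)) :=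
    Ideal.span_le.2 fun f hf =>
      Ideal.mem_map_of_mem (algebraMap _ (MvPolynomial (Fin n) ℂ))
        (show (⟨f, hf.1⟩ : polyInvariants W) ∈ 𝔪 from hf.2)
  obtain ⟨t, ht, htN⟩ := exists_smul_mem_span_of_forall_sub_mem_map 𝔪
    (Submodule.span (polyInvariants W) (Set.range e)) fun f => by
      obtain ⟨c, hc⟩ := he f
      refine ⟨_, sum_mem fun j _ => ?_, hI hc⟩
      exact Submodule.smul_mem _ (algebraMap ℂ (polyInvariants W) (c j))
        (Submodule.subset_span (Set.mem_range_self j))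
  refine ⟨t, e, ?_, fun f => ?_⟩
  · have h1 : eval 0 ((t - 1 : polyInvariants W) : MvPolynomial (Fin n) ℂ) = 0 := ht
    intro h0
    rw [AddSubgroupClass.coe_sub, map_sub, h0] at h1
    simp at h1
  · obtain ⟨r, hr⟩ := (Submodule.mem_span_range_iff_exists_fun _).1 (htN f)
    exact ⟨r, hr.symm⟩

end Coinvariants

section FreeOnRegular

variable {n : ℕ} {W : Subgroup ((Fin n → ℂ) ≃ₗ[ℂ] (Fin n → ℂ))}

/-- The linear form with given coefficients, as a polynomial. -/
def linForm : (Fin n → ℂ) →ₗ[ℂ] MvPolynomial (Fin n) ℂ :=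
  ∑ i, (LinearMap.proj i).smulRight (X i)

lemma linForm_apply (c : Fin n → ℂ) :
    linForm c = ∑ i, c i • (X i : MvPolynomial (Fin n) ℂ) := by
  simp [linForm]

/-- A prime ideal containing the determinant of the translates of local generators contains all
the differences `X i - u • X i` for some `u ≠ 1`. -/
lemma exists_forall_X_sub_smul_mem [Fintype W] (σ : Fin (Fintype.card W) ≃ W)
    {t : polyInvariants W} {e : Fin (Fintype.card W) → MvPolynomial (Fin n) ℂ}
    (he : ∀ f : MvPolynomial (Fin n) ℂ, ∃ r : Fin (Fintype.card W) → polyInvariants W,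
        t * f = ∑ j, (r j : MvPolynomial (Fin n) ℂ) * e j)
    (P : Ideal (MvPolynomial (Fin n) ℂ)) [hP : P.IsPrime]
    (ht : (t : MvPolynomial (Fin n) ℂ) ∉ P)
    (hD : (Matrix.of fun a j => σ a • e j).det ∈ P) :
    ∃ u ∈ W, u ≠ 1 ∧ ∀ i, (X i : MvPolynomial (Fin n) ℂ) - u • X i ∈ P := by
  let Q : {x : W × W // x.1 ≠ x.2} → Submodule ℂ (Fin n → ℂ) := fun x =>
    (P.restrictScalars ℂ).comap
      (((polyAct x.1.1.1).toLinearMap - (polyAct x.1.2.1).toLinearMap) ∘ₗ linForm)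
  have hQ (x c) : c ∈ Q x ↔ x.1.1 • linForm c - x.1.2 • linForm c ∈ P := Iff.rfl
  obtain ⟨x, hx⟩ : ∃ x, Q x = ⊤ := by
    by_contra! hne
    obtain ⟨c, hc⟩ := Submodule.exists_forall_notMem_of_forall_ne_top Q hne
    choose r hr using fun i : Fin (Fintype.card W) => he (linForm c ^ (i : ℕ))
    let M : Matrix (Fin (Fintype.card W)) (Fin (Fintype.card W)) (MvPolynomial (Fin n) ℂ) :=
      Matrix.of fun j i => r i j
    have hmul : (t : MvPolynomial (Fin n) ℂ) • Matrix.vandermonde (fun a => σ a • linForm c) =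
        (Matrix.of fun a j => σ a • e j) * M := by
      ext1 a i
      have := congrArg (σ a • ·) (hr i)
      simp only [Finset.smul_sum, smul_mul', smul_polyInvariants, smul_pow'] at this
      simp only [Matrix.smul_apply, Matrix.vandermonde_apply, smul_eq_mul, Matrix.mul_apply,
        Matrix.of_apply, M]
      rw [this]
      exact Finset.sum_congr rfl fun j _ => mul_comm _ _
    have hdet := congrArg Matrix.det hmul
    rw [Matrix.det_smul, Matrix.det_mul, Matrix.det_vandermonde] at hdet
    have hmem := P.mul_mem_right M.det hD
    rw [← hdet] at hmem
    rcases hP.mem_or_mem hmem with h | h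
    · exact ht (hP.mem_of_pow_mem _ h)
    · obtain ⟨a, -, h⟩ := hP.prod_mem_iff.1 h
      obtain ⟨b, hb, h⟩ := hP.prod_mem_iff.1 h
      have hab : σ b ≠ σ a := σ.injective.ne (Finset.mem_Ioi.1 hb).ne'
      exact hc ⟨(σ b, σ a), hab⟩ ((hQ _ _).2 h)
  obtain ⟨⟨⟨w, w'⟩, hne⟩, hx⟩ : ∃ x, Q x = ⊤ := ⟨x, hx⟩
  refine ⟨(w' * w⁻¹ : W), (w' * w⁻¹).2, fun h => hne ?_, fun i => ?_⟩
  · exact (mul_inv_eq_one.1 (Subtype.ext h)).symm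
  · have h1 := (hQ ⟨(w, w'), hne⟩ (fun j => (w⁻¹ : W).1⁻¹ (Pi.single j 1) i)).1 (by
      rw [hx]; trivial)
    have h2 : linForm (fun j => (w⁻¹ : W).1⁻¹ (Pi.single j 1) i) = w⁻¹ • X i := by
      change _ = polyAct (w⁻¹ : W).1 (X i)
      simp only [linForm_apply, polyAct, aeval_X, C_mul']
    rw [h2] at h1
    rw [← mul_smul, ← mul_smul, mul_inv_cancel, one_smul] at h1
    exact h1

lemma isPseudoReflection_of_forall_dvd {u : (Fin n → ℂ) ≃ₗ[ℂ] (Fin n → ℂ)} (hu : u ≠ 1)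
    {p : MvPolynomial (Fin n) ℂ} (hp0 : eval 0 p = 0) (hp : ∀ i, p ∣ X i - u • X i) :
    IsPseudoReflection u := by
  refine ⟨hu, ?_⟩
  obtain ⟨i₀, hi₀⟩ : ∃ i, (X i : MvPolynomial (Fin n) ℂ) - u • X i ≠ 0 := by
    by_contra! h
    exact hu (smul_poly_injective fun i => by rw [one_smul]; exact (sub_eq_zero.1 (h i)).symm)
  have hpne : p ≠ 0 := by
    rintro rfl
    exact hi₀ (zero_dvd_iff.1 (hp i₀))
  have hpdeg : p.totalDegree ≠ 0 := by
    intro h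
    rw [totalDegree_eq_zero_iff_eq_C] at h
    rw [h, eval_C] at hp0
    rw [hp0, C_0] at h
    exact hpne h
  have hquot (i) : ∃ a : ℂ, (X i : MvPolynomial (Fin n) ℂ) - u • X i = p * C a := by
    obtain ⟨q, hq⟩ := hp i
    by_cases hq0 : q = 0
    · exact ⟨0, by rw [hq, hq0, C_0]⟩
    have h1 := totalDegree_mul_of_isDomain hpne hq0
    have h2 := totalDegree_sub (X i : MvPolynomial (Fin n) ℂ) (u • X i)
    have h3 := totalDegree_smul_poly_le u (X i)
    rw [← hq] at h1
    rw [max_eq_left h3, totalDegree_X] at h2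
    have h4 : q.totalDegree = 0 := by omega
    rw [totalDegree_eq_zero_iff_eq_C] at h4
    exact ⟨_, by rw [hq]; exact congrArg (p * ·) h4⟩
  choose a ha using hquot
  have hev (x i) : x i - u⁻¹ x i = eval x p * a i := by
    simpa [eval_smul_poly] using congrArg (eval x) (ha i)
  have ha₀ : a i₀ ≠ 0 := by
    intro h
    apply hi₀
    rw [ha, h, C_0, mul_zero]
  let ψ : Module.Dual ℂ (Fin n → ℂ) := LinearMap.proj i₀ ∘ₗ
    (LinearMap.id - ((u⁻¹ : (Fin n → ℂ) ≃ₗ[ℂ] (Fin n → ℂ)) : (Fin n → ℂ) →ₗ[ℂ] (Fin n → ℂ)))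
  have hψ (x) : ψ x = eval x p * a i₀ := hev x i₀
  have hψ0 : ψ ≠ 0 := by
    intro h
    apply hpne
    apply MvPolynomial.funext
    intro x
    have := hψ x
    rw [h, LinearMap.zero_apply, eq_comm, mul_eq_zero] at this
    rw [map_zero]
    exact this.resolve_right ha₀
  have hker : LinearMap.ker ψ = cFixedSpace u := by
    ext x
    rw [LinearMap.mem_ker, hψ, mem_cFixedSpace, mul_eq_zero, or_iff_left ha₀]
    have hux : u x = x ↔ u⁻¹ x = x := by
      change u x = x ↔ u.symm x = x
      rw [LinearEquiv.symm_apply_eq, eq_comm]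
    rw [hux]
    constructor
    · intro h
      funext i
      have := hev x i
      rw [h, zero_mul, sub_eq_zero] at this
      exact this.symm
    · intro h
      have := hev x i₀
      rw [h, sub_self, eq_comm, mul_eq_zero] at this
      exact this.resolve_right ha₀
  have := Module.Dual.finrank_ker_add_one_of_ne_zero hψ0
  rw [hker, Module.finrank_fin_fun] at this
  omega

/-- A nontrivial element of a finite reflection group fixes only vectors lying on reflecting
hyperplanes. -/
lemma exists_isPseudoReflection_apply_eq [Fintype W]
    (hgen : Subgroup.closure {w | w ∈ W ∧ IsPseudoReflection w} = W)
    {w : (Fin n → ℂ) ≃ₗ[ℂ] (Fin n → ℂ)} (hw : w ∈ W) (hw1 : w ≠ 1) {v : Fin n → ℂ}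
    (hv : w v = v) : ∃ u ∈ W, IsPseudoReflection u ∧ u v = v := by
  obtain ⟨t, e, ht, he⟩ := exists_local_generators hgen
  let σ : Fin (Fintype.card W) ≃ W := (Fintype.equivFin W).symm
  let E : Matrix (Fin (Fintype.card W)) (Fin (Fintype.card W)) (MvPolynomial (Fin n) ℂ) :=
    Matrix.of fun a j => σ a • e j
  have hD : E.det ≠ 0 := by
    intro h
    obtain ⟨u, -, hu1, hu⟩ := exists_forall_X_sub_smul_mem σ he ⊥
      (fun h => ht (by rw [Ideal.mem_bot.1 h, map_zero])) (Ideal.mem_bot.2 h)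
    exact hu1 (smul_poly_injective fun i => by
      rw [one_smul]; exact (sub_eq_zero.1 (Ideal.mem_bot.1 (hu i))).symm)
  let φ : MvPolynomial (Fin n) ℂ →+* Polynomial ℂ :=
    (aeval fun i => Polynomial.C (v i) * Polynomial.X : _ →ₐ[ℂ] _).toRingHom
  have hφ (l : ℂ) (f) : (φ f).eval l = eval (l • v) f := by
    induction f using MvPolynomial.induction_on with
    | C a => simp [φ]
    | add p q hp hq => simp [hp, hq]
    | mul_X p i hp => 
      have hX : (φ (X i)).eval l = l * v i := by
        change Polynomial.eval l (aeval _ (X i)) = _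
        rw [aeval_X, Polynomial.eval_mul, Polynomial.eval_C, Polynomial.eval_X, mul_comm]
      rw [map_mul, Polynomial.eval_mul, hp, hX, map_mul, eval_X, Pi.smul_apply, smul_eq_mul]
  have hφD : φ E.det = 0 := by
    apply Polynomial.funext
    intro l
    rw [hφ, RingHom.map_det, Polynomial.eval_zero]
    refine Matrix.det_zero_of_row_eq (i := σ.symm 1) (j := σ.symm ⟨w, hw⟩) ?_ ?_
    · exact σ.symm.injective.ne fun h => hw1 (congrArg Subtype.val h).symm
    · funext j
      simp only [RingHom.mapMatrix_apply, Matrix.map_apply, E, Matrix.of_apply,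
        Equiv.apply_symm_apply, one_smul]
      change _ = eval (l • v) (w • e j)
      have hwv : w⁻¹ (l • v) = l • v := by
        change w.symm (l • v) = l • v
        rw [LinearEquiv.symm_apply_eq, map_smul, hv]
      rw [eval_smul_poly, hwv]
  obtain ⟨s, hirr, hassoc⟩ := WfDvdMonoid.exists_factors _ hD
  have hprod : s.prod ∈ RingHom.ker φ :=
    Ideal.mem_of_dvd _ hassoc.symm.dvd hφD
  obtain ⟨p, hps, hpφ⟩ :=
    ((RingHom.ker_isPrime φ).multiset_prod_mem_iff_exists_mem s).1 hprod
  have hpl (l : ℂ) : eval (l • v) p = 0 := by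
    rw [← hφ, RingHom.mem_ker.1 hpφ, Polynomial.eval_zero]
  have hp0 : eval 0 p = 0 := by simpa using hpl 0
  have hpv : eval v p = 0 := by simpa using hpl 1
  have hprime : Prime p := (hirr p hps).prime
  have : (Ideal.span {p}).IsPrime := (Ideal.span_singleton_prime hprime.ne_zero).2 hprime
  obtain ⟨u, huW, hu1, hu⟩ := exists_forall_X_sub_smul_mem σ he (Ideal.span {p})
    (fun h => ht (by
      obtain ⟨q, hq⟩ := Ideal.mem_span_singleton.1 h
      rw [hq, map_mul, hp0, zero_mul]))
    (Ideal.mem_span_singleton.2 ((Multiset.dvd_prod hps).trans hassoc.dvd))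
  simp only [Ideal.mem_span_singleton] at hu
  refine ⟨u, huW, isPseudoReflection_of_forall_dvd hu1 hp0 hu, ?_⟩
  suffices h : v = u⁻¹ v from (LinearEquiv.eq_symm_apply u).1 h
  funext i
  obtain ⟨q, hq⟩ := hu i
  have := congrArg (eval v) hq
  rw [map_mul, hpv, zero_mul, map_sub, eval_smul_poly, eval_X, eval_X, sub_eq_zero] at this
  exact this

end FreeOnRegular

/-- Let `N` attach to each element of a finite group a subgroup such that `B` is stable under right
multiplication of `w ∈ B` by `N w`, and this multiplication does not enlarge `N w`. If the character
`χ` is nontrivial on every `N w`, then it sums to zero over `B`. -/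
lemma sum_eq_zero_of_mul_mem {G R : Type*} [Group G] [Finite G] [CommRing R] [IsDomain R]
    (χ : G →* R) (N : G → Subgroup G) (B : Finset G)
    (hmul : ∀ w ∈ B, ∀ g ∈ N w, w * g ∈ B) (hN : ∀ w ∈ B, ∀ g ∈ N w, N (w * g) ≤ N w)
    (hχ : ∀ w ∈ B, ∃ g ∈ N w, χ g ≠ 1) : ∑ w ∈ B, χ w = 0 := by
  induction B using Finset.strongInduction with
  | H B ih =>
  rcases B.eq_empty_or_nonempty with rfl | hB
  · exact Finset.sum_empty
  obtain ⟨w, hw, hmax⟩ := B.exists_max_image (fun w => Nat.card (N w)) hB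
  have hle_eq {u} (hu : u ∈ B) (h : N w ≤ N u) : N u = N w :=
    (Subgroup.eq_of_le_of_card_ge h (hmax u hu)).symm
  let C := B.filter fun u => w⁻¹ * u ∈ N w
  let E := C.filter fun u => N u = N w
  have hCB : C ⊆ B := Finset.filter_subset _ _
  have hEC : E ⊆ C := Finset.filter_subset _ _
  have hwE : w ∈ E := by simp [E, C, hw, one_mem]
  have hNC {u} (hu : u ∈ C) : N u ≤ N w := by
    have := hN w hw _ (Finset.mem_filter.1 hu).2
    rwa [mul_inv_cancel_left] at this
  have hCmul {u} (hu : u ∈ C) {g} (hg : g ∈ N w) (h : u * g ∈ B) : u * g ∈ C :=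
    Finset.mem_filter.2 ⟨h, by
      rw [← mul_assoc]; exact mul_mem (Finset.mem_filter.1 hu).2 hg⟩
  have hdiff (D : Finset G) (hDB : D ⊆ B) (hED : E ⊆ D)
      (hD : ∀ u ∈ D, ∀ g ∈ N u, u * g ∈ D) : ∑ u ∈ D \ E, χ u = 0 := by
    have hsub : D \ E ⊆ B := Finset.sdiff_subset.trans hDB
    refine ih _ (Finset.ssubset_iff_of_subset hsub |>.2 ⟨w, hw, by simp [hwE]⟩) ?_
      (fun u hu => hN u (hsub hu)) (fun u hu => hχ u (hsub hu))
    intro u hu g hg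
    rw [Finset.mem_sdiff] at hu ⊢
    refine ⟨hD u hu.1 g hg, fun hE => hu.2 ?_⟩
    obtain ⟨hC, hEq⟩ := Finset.mem_filter.1 hE
    have hNu : N u = N w := hle_eq (hDB hu.1) (hEq ▸ hN u (hDB hu.1) g hg)
    refine Finset.mem_filter.2 ⟨?_, hNu⟩
    have := hCmul hC (inv_mem (hNu ▸ hg)) (by rw [mul_inv_cancel_right]; exact hDB hu.1)
    rwa [mul_inv_cancel_right] at this
  have hsumC : ∑ u ∈ C, χ u = 0 := by
    obtain ⟨g, hg, hg1⟩ := hχ w hw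
    have hBC {h} (hh : h ∈ N w) {u} (hu : u ∈ C) : u * h ∈ C := by
      refine hCmul hu hh ?_
      have := hmul w hw _ (mul_mem (Finset.mem_filter.1 hu).2 hh)
      rwa [← mul_assoc, mul_inv_cancel_left] at this
    have h : ∑ u ∈ C, χ u = ∑ u ∈ C, χ u * χ g := by
      refine Finset.sum_nbij' (· * g⁻¹) (· * g) (fun u hu => hBC (inv_mem hg) hu)
        (fun u hu => hBC hg hu) (by simp) (by simp) fun u _ => ?_
      rw [← map_mul, inv_mul_cancel_right]
    rw [← Finset.sum_mul] at h
    by_contra hne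
    exact hg1 (mul_left_cancel₀ hne (by rw [mul_one]; exact h.symm))
  rw [← Finset.sum_sdiff (hEC.trans hCB), hdiff B subset_rfl (hEC.trans hCB) hmul, zero_add]
  rw [← Finset.sum_sdiff hEC, hdiff C hCB hEC ?_, zero_add] at hsumC
  · exact hsumC
  · exact fun u hu g hg => hCmul hu (hNC hu hg) (hmul u (hCB hu) g hg)

section Moebius

variable {n : ℕ} {W : Subgroup ((Fin n → ℂ) ≃ₗ[ℂ] (Fin n → ℂ))}

/-- The determinant as a character of a linear group. -/
def detHom (W : Subgroup ((Fin n → ℂ) ≃ₗ[ℂ] (Fin n → ℂ))) : W →* ℂ :=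
  (LinearMap.det.comp LinearEquiv.automorphismGroup.toLinearMapMonoidHom).comp W.subtype

/-- The pointwise stabilizer in `W` of a subspace. -/
def pointwiseFixer (W : Subgroup ((Fin n → ℂ) ≃ₗ[ℂ] (Fin n → ℂ)))
    (Y : Submodule ℂ (Fin n → ℂ)) : Subgroup W where
  carrier := {w | ∀ y ∈ Y, w.1 y = y}
  one_mem' _ _ := rfl
  mul_mem' {a b} ha hb y hy := by
    change a.1 (b.1 y) = y
    rw [hb y hy, ha y hy]
  inv_mem' {a} ha y hy := (LinearEquiv.symm_apply_eq a.1).2 (ha y hy).symm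

lemma mem_pointwiseFixer {Y : Submodule ℂ (Fin n → ℂ)} {w : W} :
    w ∈ pointwiseFixer W Y ↔ Y ≤ cFixedSpace w.1 :=
  forall₂_congr fun _ _ => mem_cFixedSpace.symm

/-- The subgroup generated by the reflections of `W` that fix a subspace pointwise. -/
def reflFixer (W : Subgroup ((Fin n → ℂ) ≃ₗ[ℂ] (Fin n → ℂ)))
    (Y : Submodule ℂ (Fin n → ℂ)) : Subgroup W :=
  Subgroup.closure {s | IsPseudoReflection s.1 ∧ Y ≤ cFixedSpace s.1}

lemma reflFixer_anti {Y Z : Submodule ℂ (Fin n → ℂ)} (h : Y ≤ Z) :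
    reflFixer W Z ≤ reflFixer W Y :=
  Subgroup.closure_mono fun _ hs => ⟨hs.1, h.trans hs.2⟩

/-- The smallest element of the intersection lattice containing a subspace. -/
def flatHull (W : Subgroup ((Fin n → ℂ) ≃ₗ[ℂ] (Fin n → ℂ)))
    (Y : Submodule ℂ (Fin n → ℂ)) : Submodule ℂ (Fin n → ℂ) :=
  sInf {H ∈ cReflHyperplanes W | Y ≤ H}

lemma flatHull_mem (Y : Submodule ℂ (Fin n → ℂ)) : flatHull W Y ∈ cIntLattice W :=
  ⟨_, Set.sep_subset _ _, rfl⟩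

lemma le_flatHull (Y : Submodule ℂ (Fin n → ℂ)) : Y ≤ flatHull W Y :=
  le_sInf fun _ h => h.2

lemma flatHull_le {Y Z : Submodule ℂ (Fin n → ℂ)} (hZ : Z ∈ cIntLattice W) (h : Y ≤ Z) :
    flatHull W Y ≤ Z := by
  obtain ⟨s, hs, rfl⟩ := hZ
  exact le_sInf fun H hH => sInf_le ⟨hs hH, h.trans (sInf_le hH)⟩

lemma reflFixer_le_pointwiseFixer (Y : Submodule ℂ (Fin n → ℂ)) :
    reflFixer W Y ≤ pointwiseFixer W (flatHull W Y) := by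
  rw [reflFixer, Subgroup.closure_le]
  exact fun s hs => mem_pointwiseFixer.2 (sInf_le ⟨⟨s.1, s.2, hs.1, rfl⟩, hs.2⟩)

lemma exists_mem_reflFixer_detHom_ne_one [Finite W] {Y : Submodule ℂ (Fin n → ℂ)}
    (h : ∃ u ∈ W, IsPseudoReflection u ∧ Y ≤ cFixedSpace u) :
    ∃ g ∈ reflFixer W Y, detHom W g ≠ 1 := by
  obtain ⟨u, huW, hu, hY⟩ := h
  refine ⟨⟨u, huW⟩, Subgroup.subset_closure ⟨hu, hY⟩, hu.det_ne_one ?_⟩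
  exact W.subtype.isOfFinOrder (isOfFinOrder_of_finite (⟨u, huW⟩ : W))

lemma cFixedSpace_eq_top_iff {w : (Fin n → ℂ) ≃ₗ[ℂ] (Fin n → ℂ)} :
    cFixedSpace w = ⊤ ↔ w = 1 := by
  rw [Submodule.eq_top_iff']
  simp only [mem_cFixedSpace]
  exact (LinearEquiv.ext_iff (e := w) (e' := 1)).symm

lemma exists_isPseudoReflection_le_cFixedSpace [Fintype W]
    (hgen : Subgroup.closure {w | w ∈ W ∧ IsPseudoReflection w} = W)
    {w : (Fin n → ℂ) ≃ₗ[ℂ] (Fin n → ℂ)} (hw : w ∈ W) (hw1 : w ≠ 1) :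
    ∃ u ∈ W, IsPseudoReflection u ∧ cFixedSpace w ≤ cFixedSpace u := by
  by_contra! h
  let Q : {u : W // IsPseudoReflection u.1} → Submodule ℂ (cFixedSpace w) := fun u =>
    (cFixedSpace u.1.1).comap (cFixedSpace w).subtype
  have hQ (u) : Q u ≠ ⊤ := fun hu =>
    h u.1.1 u.1.2 u.2 (Submodule.comap_subtype_eq_top.1 hu)
  obtain ⟨v, hv⟩ := Submodule.exists_forall_notMem_of_forall_ne_top Q hQ
  obtain ⟨u, huW, hu, huv⟩ :=
    exists_isPseudoReflection_apply_eq hgen hw hw1 (mem_cFixedSpace.1 v.2)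
  exact hv ⟨⟨u, huW⟩, hu⟩ (mem_cFixedSpace.2 huv)

/-- The determinants of the elements of `W` fixing `Y` pointwise, and whose fixed space belongs to
the intersection lattice, sum to zero. -/
lemma sum_detHom_filter_mem_cIntLattice [Fintype W]
    (hgen : Subgroup.closure {w | w ∈ W ∧ IsPseudoReflection w} = W)
    {Y : Submodule ℂ (Fin n → ℂ)} (hY : Y ∈ cIntLattice W) (hYtop : Y ≠ ⊤) :
    ∑ w : W with Y ≤ cFixedSpace w.1 ∧ cFixedSpace w.1 ∈ cIntLattice W, detHom W w = 0 := by
  have hall : ∑ w : W with Y ≤ cFixedSpace w.1, detHom W w = 0 := by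
    refine sum_eq_zero_of_mul_mem _ (fun _ => pointwiseFixer W Y) _ (fun w hw g hg => ?_)
      (fun _ _ _ _ => le_rfl) fun w _ => ?_
    · simp only [Finset.mem_filter_univ, ← mem_pointwiseFixer] at hw ⊢
      exact mul_mem hw hg
    · obtain ⟨s, hs, rfl⟩ := id hY
      obtain ⟨H, hH⟩ : s.Nonempty := by
        rw [Set.nonempty_iff_ne_empty]
        rintro rfl
        exact hYtop sInf_empty
      obtain ⟨u, huW, hu, rfl⟩ := hs hH
      obtain ⟨g, hg, hg1⟩ := exists_mem_reflFixer_detHom_ne_one ⟨u, huW, hu, sInf_le hH⟩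
      refine ⟨g, mem_pointwiseFixer.2 ((le_flatHull _).trans
        (mem_pointwiseFixer.1 (reflFixer_le_pointwiseFixer _ hg))), hg1⟩
  have hbad : ∑ w : W with Y ≤ cFixedSpace w.1 ∧ cFixedSpace w.1 ∉ cIntLattice W,
      detHom W w = 0 := by
    have hle {w g : W} (hg : g ∈ reflFixer W (cFixedSpace w.1)) :
        cFixedSpace w.1 ≤ cFixedSpace (w * g).1 := by
      rw [← mem_pointwiseFixer]
      exact mul_mem (mem_pointwiseFixer.2 le_rfl) (mem_pointwiseFixer.2
        ((le_flatHull _).trans (mem_pointwiseFixer.1 (reflFixer_le_pointwiseFixer _ hg))))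
    refine sum_eq_zero_of_mul_mem _ (fun w => reflFixer W (cFixedSpace w.1)) _
      (fun w hw g hg => ?_) (fun w _ g hg => reflFixer_anti (hle hg)) fun w hw => ?_
    · simp only [Finset.mem_filter_univ] at hw ⊢
      refine ⟨hw.1.trans (hle hg), fun hL => hw.2 ?_⟩
      have hwg := mem_pointwiseFixer.2 (flatHull_le hL (hle hg))
      have hw' := mul_mem hwg (inv_mem (reflFixer_le_pointwiseFixer _ hg))
      rw [mul_inv_cancel_right, mem_pointwiseFixer] at hw'
      rw [← hw'.antisymm (le_flatHull _)]
      exact flatHull_mem _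
    · rw [Finset.mem_filter_univ] at hw
      refine exists_mem_reflFixer_detHom_ne_one
        (exists_isPseudoReflection_le_cFixedSpace hgen w.2 fun h => hw.2 ?_)
      rw [cFixedSpace_eq_top_iff.2 h]
      exact ⟨∅, Set.empty_subset _, sInf_empty.symm⟩
  rw [← Finset.sum_filter_add_sum_filter_not _ (fun w : W => cFixedSpace w.1 ∈ cIntLattice W),
    Finset.filter_filter, Finset.filter_filter, hbad, add_zero] at hall
  exact hall

end Moebius

/-- For a finite complex reflection group `W` acting on `V = ℂⁿ`, the Möbius function of the
intersection lattice of its reflection arrangement (ordered by reverse inclusion, with bottom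
element `V = ⊤`, characterized by `μ(V,V) = 1` and `∑_{V ≤ Z ≤ X} μ(V,Z) = 0` for `X ≠ V`)
satisfies `μ(V, X) = ∑_{w ∈ W : V^w = X} det(w)`. -/
theorem stmt5 (n : ℕ) (W : Subgroup ((Fin n → ℂ) ≃ₗ[ℂ] (Fin n → ℂ)))
    [Fintype W]
    (hgen : Subgroup.closure {w | w ∈ W ∧ IsPseudoReflection w} = W)
    [Fintype (cIntLattice W)]
    (μ : cIntLattice W → ℤ)
    (hμ1 : ∀ X : cIntLattice W, (X : Submodule ℂ (Fin n → ℂ)) = ⊤ → μ X = 1)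
    (hμ2 : ∀ X : cIntLattice W, (X : Submodule ℂ (Fin n → ℂ)) ≠ ⊤ →
      ∑ Z : cIntLattice W,
        (if (X : Submodule ℂ (Fin n → ℂ)) ≤ Z then μ Z else 0) = 0) :
    ∀ X : cIntLattice W,
      (μ X : ℂ) = ∑ w : W,
        (if cFixedSpace (w : (Fin n → ℂ) ≃ₗ[ℂ] (Fin n → ℂ)) = (X : Submodule ℂ (Fin n → ℂ))
          then LinearMap.det
            ((w : (Fin n → ℂ) ≃ₗ[ℂ] (Fin n → ℂ)) : (Fin n → ℂ) →ₗ[ℂ] (Fin n → ℂ))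
          else 0) := by
  let f (Y : Submodule ℂ (Fin n → ℂ)) : ℂ := ∑ w : W with cFixedSpace w.1 = Y, detHom W w
  suffices h : ∀ X : cIntLattice W, (μ X : ℂ) = f X from fun X =>
    (h X).trans (Finset.sum_filter _ _)
  have hf (X : cIntLattice W) (hX : X.1 ≠ ⊤) :
      ∑ Z : cIntLattice W with X ≤ Z, f Z = 0 := by
    rw [← sum_detHom_filter_mem_cIntLattice hgen X.2 hX, Finset.sum_sigma']
    refine Finset.sum_bij' (fun p _ => p.2)
      (fun w hw => ⟨⟨cFixedSpace w.1, (Finset.mem_filter_univ _ |>.1 hw).2⟩, w⟩) ?_ ?_ ?_ ?_ ?_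
    · rintro ⟨Z, w⟩ h
      simp only [Finset.mem_sigma, Finset.mem_filter_univ] at h ⊢
      rw [h.2]
      exact ⟨h.1, Z.2⟩
    · intro w hw
      simp only [Finset.mem_sigma, Finset.mem_filter_univ] at hw ⊢
      exact ⟨hw.1, trivial⟩
    · rintro ⟨⟨Z, hZ⟩, w⟩ h
      simp only [Finset.mem_sigma, Finset.mem_filter_univ] at h
      obtain rfl := h.2
      rfl
    · exact fun _ _ => rfl
    · exact fun _ _ => rfl
  intro X
  induction X using (Finite.to_wellFoundedGT (α := cIntLattice W)).induction with
  | ind X ih =>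
  by_cases hX : X.1 = ⊤
  · rw [hμ1 X hX]
    simp only [f, hX, cFixedSpace_eq_top_iff, OneMemClass.coe_eq_one]
    rw [Finset.sum_filter, Finset.sum_ite_eq' Finset.univ (1 : W), if_pos (Finset.mem_univ _),
      map_one, Int.cast_one]
  · have h1 : ∑ Z : cIntLattice W with X ≤ Z, (μ Z : ℂ) = 0 := by
      rw [Finset.sum_filter]
      exact_mod_cast hμ2 X hX
    have h2 := hf X hX
    have hmem : X ∈ Finset.univ.filter fun Z : cIntLattice W => X ≤ Z := by simp
    rw [← Finset.add_sum_erase _ _ hmem] at h1 h2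
    have h3 : ∑ Z ∈ (Finset.univ.filter fun Z : cIntLattice W => X ≤ Z).erase X, (μ Z : ℂ) =
        ∑ Z ∈ (Finset.univ.filter fun Z : cIntLattice W => X ≤ Z).erase X, f Z := by
      refine Finset.sum_congr rfl fun Z hZ => ih Z ?_
      rw [Finset.mem_erase, Finset.mem_filter_univ] at hZ
      exact lt_of_le_of_ne hZ.2 hZ.1.symm
    rw [h3] at h1
    exact add_right_cancel (h1.trans h2.symm)

end
end
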